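/- arXiv:1405.5268 — 6 statements merged into one kernel-verified Lean document; each statement's English description precedes it below -/
import Mathlib

section
/- Let f : {-1,1}^n → {-1,1} be a Boolean function and let 0 ≤ d ≤ n. Let α be the minimum of E_x[|f(x) − g(x)|] over all d-resilient functions g : {-1,1}^n → [-1,1] (the minimum exists by compactness). Then the minimum over all real multilinear polynomials p of degree at most d of E_x[|f(x) − p(x)|] equals 1 − α. In particular, f is α-approximately d-resilient if and only if Δ_{P_d}(f) ≥ 1 − α. -/
open Finset

noncomputable section

/-- The value `±1` of a bit, with `true ↦ 1` and `false ↦ -1`. -/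
def sgn (b : Bool) : ℝ := if b then 1 else -1

/-- Expectation of `f` over a uniformly random point of the hypercube `{-1,1}^ι`. -/
def expect {ι : Type*} [Fintype ι] [DecidableEq ι] (f : (ι → Bool) → ℝ) : ℝ :=
  (∑ x : ι → Bool, f x) / 2 ^ (Fintype.card ι)

/-- Fourier coefficient `ĝ(S) = E[g(x) ∏_{i ∈ S} x_i]`. -/
def fcoef {ι : Type*} [Fintype ι] [DecidableEq ι] (g : (ι → Bool) → ℝ) (S : Finset ι) : ℝ :=
  expect (fun x => g x * ∏ i ∈ S, sgn (x i))

/-- `g` is `d`-resilient if all its Fourier coefficients of degree at most `d` vanish. -/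
def Resilient {ι : Type*} [Fintype ι] [DecidableEq ι] (d : ℕ) (g : (ι → Bool) → ℝ) : Prop :=
  ∀ S : Finset ι, S.card ≤ d → fcoef g S = 0

/-- `f` is Boolean-valued (takes values in `{-1,1}`). -/
def IsBooleanValued {ι : Type*} (f : (ι → Bool) → ℝ) : Prop := ∀ x, f x = 1 ∨ f x = -1

/-- `g` is bounded (takes values in `[-1,1]`). -/
def IsBounded {ι : Type*} (g : (ι → Bool) → ℝ) : Prop := ∀ x, |g x| ≤ 1

/-- `f` is `α`-approximately `d`-resilient: `f` is `α`-close in `ℓ₁` to a bounded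
`d`-resilient function. -/
def ApproxResilient {ι : Type*} [Fintype ι] [DecidableEq ι] (α : ℝ) (d : ℕ)
    (f : (ι → Bool) → ℝ) : Prop :=
  ∃ g : (ι → Bool) → ℝ, Resilient d g ∧ IsBounded g ∧ expect (fun x => |f x - g x|) ≤ α

/-- `p` is (the restriction to the hypercube of) a multilinear polynomial of degree at most `d`,
i.e. all its Fourier coefficients of degree greater than `d` vanish. -/
def DegLE {ι : Type*} [Fintype ι] [DecidableEq ι] (d : ℕ) (p : (ι → Bool) → ℝ) : Prop :=
  ∀ S : Finset ι, d < S.card → fcoef p S = 0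

section Fourier

variable {ι : Type*} [Fintype ι] [DecidableEq ι]

lemma sgn_mul_self (b : Bool) : sgn b * sgn b = 1 := by
  cases b <;> simp [sgn]

lemma expect_add (f g : (ι → Bool) → ℝ) :
    expect (fun x => f x + g x) = expect f + expect g := by
  simp only [_root_.expect, sum_add_distrib, add_div]

lemma expect_sub (f g : (ι → Bool) → ℝ) :
    expect (fun x => f x - g x) = expect f - expect g := by
  simp only [_root_.expect, sum_sub_distrib, sub_div]

lemma expect_const_mul (c : ℝ) (f : (ι → Bool) → ℝ) :
    expect (fun x => c * f x) = c * expect f := by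
  simp only [_root_.expect, ← mul_sum, mul_div_assoc]

lemma expect_one : expect (fun _ : ι → Bool => 1) = 1 := by
  simp [_root_.expect]

lemma expect_mono {f g : (ι → Bool) → ℝ} (h : ∀ x, f x ≤ g x) : expect f ≤ expect g :=
  div_le_div_of_nonneg_right (sum_le_sum fun x _ => h x) (by positivity)

/-- Distinct characters are orthogonal. -/
lemma fcoef_character_of_ne {S T : Finset ι} (h : S ≠ T) :
    fcoef (fun x => ∏ i ∈ S, sgn (x i)) T = 0 := by
  obtain ⟨i, hi⟩ : ∃ i, ¬(i ∈ S ↔ i ∈ T) := by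
    by_contra! hc
    exact h (Finset.ext hc)
  have key : ∀ x : ι → Bool, (∏ i ∈ S, sgn (x i)) * ∏ i ∈ T, sgn (x i) =
      ∏ i, (if i ∈ S then sgn (x i) else 1) * (if i ∈ T then sgn (x i) else 1) := fun x => by
    rw [prod_mul_distrib, prod_ite_mem, prod_ite_mem, univ_inter, univ_inter]
  simp only [fcoef, _root_.expect, key]
  rw [← Fintype.prod_sum fun i b =>
    (if i ∈ S then sgn b else 1) * (if i ∈ T then sgn b else 1),
    prod_eq_zero (mem_univ i), zero_div]
  by_cases hS : i ∈ S <;> by_cases hT : i ∈ T <;> simp_all [sgn]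

lemma sum_character_mul_character {κ : Type*} [Fintype κ] (x y : κ → Bool) :
    ∑ S : Finset κ, (∏ i ∈ S, sgn (x i)) * ∏ i ∈ S, sgn (y i) =
      if x = y then 2 ^ Fintype.card κ else 0 := by
  simp only [← prod_mul_distrib]
  rw [← powerset_univ, ← prod_one_add]
  split_ifs with h
  · subst h
    simp only [sgn_mul_self]
    norm_num
  · obtain ⟨i, hi⟩ := Function.ne_iff.mp h
    refine prod_eq_zero (mem_univ i) ?_
    cases hx : x i <;> cases hy : y i <;> simp_all [sgn]

lemma fourier_inversion (g : (ι → Bool) → ℝ) (x : ι → Bool) :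
    g x = ∑ S : Finset ι, fcoef g S * ∏ i ∈ S, sgn (x i) := by
  simp only [fcoef, _root_.expect, div_mul_eq_mul_div, ← sum_div, sum_mul]
  rw [sum_comm]
  simp only [mul_assoc, ← mul_sum, sum_character_mul_character]
  simp

lemma parseval (g p : (ι → Bool) → ℝ) :
    expect (fun x => g x * p x) = ∑ S : Finset ι, fcoef g S * fcoef p S := by
  have h : ∀ x, g x * p x = ∑ S : Finset ι, fcoef p S * (g x * ∏ i ∈ S, sgn (x i)) := fun x => by
    conv_lhs => rw [fourier_inversion p x, mul_sum]
    exact sum_congr rfl fun S _ => by ring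
  simp only [h, _root_.expect]
  rw [sum_comm, sum_div]
  refine sum_congr rfl fun S _ => ?_
  rw [← mul_sum, mul_div_assoc, mul_comm]
  rfl

lemma Resilient.expect_mul_eq_zero {d : ℕ} {g p : (ι → Bool) → ℝ} (hg : Resilient d g)
    (hp : DegLE d p) : expect (fun x => g x * p x) = 0 := by
  rw [parseval]
  refine sum_eq_zero fun S _ => ?_
  rcases le_or_gt S.card d with h | h
  · rw [hg S h, zero_mul]
  · rw [hp S h, mul_zero]

lemma degLE_character {d : ℕ} {S : Finset ι} (hS : S.card ≤ d) :
    DegLE d fun x : ι → Bool => ∏ i ∈ S, sgn (x i) := fun T hT =>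
  fcoef_character_of_ne (by rintro rfl; omega)

/-- Weak duality between bounded resilient functions and low-degree approximation. -/
lemma expect_mul_le_expect_abs_sub {d : ℕ} (f : (ι → Bool) → ℝ) {g p : (ι → Bool) → ℝ}
    (hg : Resilient d g) (hb : IsBounded g) (hp : DegLE d p) :
    expect (fun x => f x * g x) ≤ expect (fun x => |f x - p x|) := by
  have h : expect (fun x => f x * g x) = expect (fun x => (f x - p x) * g x) := by
    rw [← sub_zero (expect fun x => f x * g x), ← hg.expect_mul_eq_zero hp, ← expect_sub]
    congr 1; ext x; ring
  rw [h]
  refine expect_mono fun x => (le_abs_self _).trans ?_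
  rw [abs_mul]
  exact mul_le_of_le_one_right (abs_nonneg _) (hb x)

lemma IsBooleanValued.expect_abs_sub {f g : (ι → Bool) → ℝ} (hf : IsBooleanValued f)
    (hg : IsBounded g) :
    expect (fun x => |f x - g x|) = 1 - expect (fun x => f x * g x) := by
  rw [← expect_one (ι := ι), ← expect_sub]
  congr 1; ext x
  have := abs_le.mp (hg x)
  rcases hf x with h | h <;> rw [h]
  · rw [abs_of_nonneg] <;> linarith
  · rw [abs_of_nonpos] <;> linarith

/-- The functions of degree at most `d`, as a subspace of `ℓ₁` of the hypercube. -/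
def lowDegree (ι : Type*) [Fintype ι] [DecidableEq ι] (d : ℕ) :
    Submodule ℝ (PiLp 1 fun _ : ι → Bool => ℝ) where
  carrier := {p | DegLE d p.ofLp}
  zero_mem' S _ := by simp [fcoef, _root_.expect]
  add_mem' {p q} hp hq S hS := by
    have := expect_add (fun x => p x * ∏ i ∈ S, sgn (x i)) (fun x => q x * ∏ i ∈ S, sgn (x i))
    simp only [← add_mul] at this
    exact this.trans (by rw [← fcoef, ← fcoef, hp S hS, hq S hS, add_zero])
  smul_mem' c p hp S hS := by
    have := expect_const_mul c (fun x => p x * ∏ i ∈ S, sgn (x i))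
    simp only [← mul_assoc] at this
    exact this.trans (by rw [← fcoef, hp S hS, mul_zero])

/-- Strong duality: a best low-degree approximation of `f` and a bounded resilient function
certifying its optimality. -/
lemma exists_resilient_expect_mul_eq (d : ℕ) (f : (ι → Bool) → ℝ) :
    ∃ g p : (ι → Bool) → ℝ, Resilient d g ∧ IsBounded g ∧ DegLE d p ∧
      expect (fun x => |f x - p x|) = expect (fun x => f x * g x) := by
  let W := lowDegree ι d
  have hW : IsClosed (W : Set (PiLp 1 fun _ : ι → Bool => ℝ)) := W.closed_of_finiteDimensional
  let F : PiLp 1 (fun _ : ι → Bool => ℝ) := WithLp.toLp 1 f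
  obtain ⟨p, hpW, hp⟩ := hW.exists_infDist_eq_dist ⟨0, W.zero_mem⟩ F
  obtain ⟨φ, hφ, hφF⟩ := exists_dual_vector'' ℝ (W.mkQ F)
  have bound : ∀ u, |φ (W.mkQ u)| ≤ ‖u‖ := fun u => by
    have h1 := φ.le_of_opNorm_le hφ (W.mkQ u)
    rw [one_mul, Real.norm_eq_abs] at h1
    exact h1.trans (Submodule.Quotient.norm_mk_le W u)
  let g : (ι → Bool) → ℝ := fun x => φ (W.mkQ (WithLp.toLp 1 (Pi.single x 1)))
  have rep : ∀ u : (ι → Bool) → ℝ, φ (W.mkQ (WithLp.toLp 1 u)) = ∑ x, u x * g x := fun u => by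
    have hu : WithLp.toLp 1 u =
        ∑ x, u x • (WithLp.toLp 1 (Pi.single x 1) : PiLp 1 fun _ : ι → Bool => ℝ) := by
      ext y
      simp [Pi.single_apply]
    rw [hu]
    simp only [map_sum, map_smul, smul_eq_mul, g]
  refine ⟨g, p.ofLp, fun S hS => ?_, fun x => ?_, hpW, ?_⟩
  · have hmem : (WithLp.toLp 1 fun x : ι → Bool => ∏ i ∈ S, sgn (x i)) ∈ W :=
      degLE_character hS
    have h0 := rep fun x => ∏ i ∈ S, sgn (x i)
    rw [Submodule.mkQ_apply, (Submodule.Quotient.mk_eq_zero W).mpr hmem, map_zero] at h0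
    simp only [fcoef, _root_.expect, mul_comm (g _), ← h0, zero_div]
  · refine (bound _).trans ?_
    simp
  · have h1 := rep f
    have h2 : ‖W.mkQ F‖ = ‖F - p‖ := by
      rw [← dist_eq_norm, ← hp]
      exact QuotientAddGroup.norm_mk F
    have h3 : ‖F - p‖ = ∑ x, |f x - p x| := by
      simp [PiLp.norm_eq_of_L1, F]
    simp only [_root_.expect]
    rw [← h1, ← h3, ← h2]
    exact congrArg (· / _) hφF.symm

end Fourier

/-- **Duality between approximate resilience and `ℓ₁` approximation by low-degree polynomials.**
If `α` is the minimum `ℓ₁` distance from a Boolean `f` to a bounded `d`-resilient function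
(the minimum exists), then the minimum `ℓ₁` distance from `f` to a degree-`d` polynomial
exists and equals `1 - α`.  In particular, `f` is `β`-approximately `d`-resilient iff
`Δ_{P_d}(f) ≥ 1 - β`. -/
theorem stmt0 (n d : ℕ) (hd : d ≤ n) (f : (Fin n → Bool) → ℝ) (hf : IsBooleanValued f) :
    ∃ α : ℝ,
      IsLeast {β : ℝ | ∃ g : (Fin n → Bool) → ℝ,
          Resilient d g ∧ IsBounded g ∧ expect (fun x => |f x - g x|) = β} α ∧
      IsLeast {β : ℝ | ∃ p : (Fin n → Bool) → ℝ,
          DegLE d p ∧ expect (fun x => |f x - p x|) = β} (1 - α) ∧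
      ∀ β : ℝ, ApproxResilient β d f ↔
        ∀ p : (Fin n → Bool) → ℝ, DegLE d p → 1 - β ≤ expect (fun x => |f x - p x|) := by
  obtain ⟨g, p, hg, hb, hp, hgp⟩ := exists_resilient_expect_mul_eq d f
  have hgα := hf.expect_abs_sub hb
  have hmin : ∀ g' : (Fin n → Bool) → ℝ, Resilient d g' → IsBounded g' →
      1 - expect (fun x => f x * g x) ≤ expect (fun x => |f x - g' x|) := fun g' hg' hb' => by
    rw [hf.expect_abs_sub hb', ← hgp]
    exact sub_le_sub_left (expect_mul_le_expect_abs_sub f hg' hb' hp) 1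
  refine ⟨1 - expect (fun x => f x * g x), ⟨⟨g, hg, hb, hgα⟩, ?_⟩, ⟨⟨p, hp, ?_⟩, ?_⟩,
    fun β => ⟨?_, fun h => ⟨g, hg, hb, ?_⟩⟩⟩
  · rintro _ ⟨g', hg', hb', rfl⟩
    exact hmin g' hg' hb'
  · rw [hgp, sub_sub_cancel]
  · rintro _ ⟨q, hq, rfl⟩
    rw [sub_sub_cancel]
    exact expect_mul_le_expect_abs_sub f hg hb hq
  · rintro ⟨g', hg', hb', hβ⟩ q hq
    linarith [hmin g' hg' hb', expect_mul_le_expect_abs_sub f hg hb hq]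
  · linarith [h p hp]
end
end

section
/- Let X be a finite nonempty set, let Π = Π₁ × ⋯ × Πₙ be a product probability distribution on Xⁿ, let f : Xⁿ → {-1,1}, and let 0 ≤ d ≤ n. Say that g : Xⁿ → [-1,1] is d-resilient relative to Π if E_{x∼Π}[g(x)·h(x)] = 0 for every function h : Xⁿ → ℝ that depends on at most d coordinates. Let J_d denote the linear span of all real-valued functions on Xⁿ depending on at most d coordinates, and let α be the minimum of E_{x∼Π}[|f(x) − g(x)|] over all g that are d-resilient relative to Π. Then min_{p∈J_d} E_{x∼Π}[|f(x) − p(x)|] = 1 − α. -/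
open Finset

noncomputable section

/-- Expectation of `F` over `x ∼ Π = Π₁ × ⋯ × Πₙ`, where `π i` is the weight function of the
`i`-th marginal distribution. -/
def pexpect {X : Type*} [Fintype X] {n : ℕ} (π : Fin n → X → ℝ) (F : (Fin n → X) → ℝ) : ℝ :=
  ∑ x : Fin n → X, (∏ i, π i (x i)) * F x

/-- `h : Xⁿ → ℝ` depends on at most `d` coordinates. -/
def DependsOnAtMost {X : Type*} {n : ℕ} (d : ℕ) (h : (Fin n → X) → ℝ) : Prop :=
  ∃ S : Finset (Fin n), S.card ≤ d ∧
    ∀ x y : Fin n → X, (∀ i ∈ S, x i = y i) → h x = h y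

/-- A weighted `ℓ¹` best approximation from a subspace exists, and its error is attained by a
sign-bounded weight orthogonal to the subspace. -/
theorem exists_weighted_l1_approx_dual {ι : Type*} [Fintype ι] (w f : ι → ℝ)
    (hw : ∀ x, 0 ≤ w x) (J : Submodule ℝ (ι → ℝ)) :
    ∃ p ∈ J, ∃ g : ι → ℝ, (∀ x, |g x| ≤ 1) ∧ (∀ h ∈ J, ∑ x, w x * (g x * h x) = 0) ∧
      ∑ x, w x * |f x - p x| = ∑ x, w x * (f x * g x) := by
  classical
  let T : (ι → ℝ) →ₗ[ℝ] PiLp 1 (fun _ : ι => ℝ) :=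
    { toFun := fun u => WithLp.toLp 1 fun x => w x * u x
      map_add' := fun u v => by ext x; simp [mul_add]
      map_smul' := fun c u => by ext x; simp [mul_left_comm] }
  have T_apply (u : ι → ℝ) (x : ι) : T u x = w x * u x := rfl
  let K := J.map T
  have hK : IsClosed (K : Set (PiLp 1 (fun _ : ι => ℝ))) := K.closed_of_finiteDimensional
  obtain ⟨q, hq, hdist⟩ := hK.exists_infDist_eq_dist ⟨0, K.zero_mem⟩ (T f)
  obtain ⟨p, hp, rfl⟩ := hq
  obtain ⟨φ, hφ, hφf⟩ := exists_dual_vector'' ℝ (K.mkQ (T f))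
  have hnorm : ‖K.mkQ (T f)‖ = Metric.infDist (T f) K :=
    QuotientAddGroup.norm_mk (S := K.toAddSubgroup) (T f)
  have hsum (v : PiLp 1 (fun _ : ι => ℝ)) :
      φ (K.mkQ v) = ∑ x, v x * φ (K.mkQ (PiLp.single 1 x 1)) := by
    have hv : v = ∑ x, v x • PiLp.single 1 x (1 : ℝ) := by
      ext y
      simp [Pi.single_apply]
    conv_lhs => rw [hv]
    simp only [map_sum, map_smul, smul_eq_mul]
  refine ⟨p, hp, fun x => φ (K.mkQ (PiLp.single 1 x 1)), fun x => ?_, fun h hh => ?_, ?_⟩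
  · calc |φ (K.mkQ (PiLp.single 1 x 1))| ≤ ‖φ‖ * ‖K.mkQ (PiLp.single 1 x (1 : ℝ))‖ :=
          φ.le_opNorm _
      _ ≤ 1 * ‖PiLp.single 1 x (1 : ℝ)‖ := by
          gcongr
          exact Submodule.Quotient.norm_mk_le K _
      _ = 1 := by simp
  · have hzero : K.mkQ (T h) = 0 := by
      rw [Submodule.mkQ_apply, Submodule.Quotient.mk_eq_zero]
      exact Submodule.mem_map_of_mem hh
    have := hsum (T h)
    rw [hzero, map_zero] at this
    rw [this]
    exact Finset.sum_congr rfl fun x _ => by rw [T_apply]; ring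
  · have hd : dist (T f) (T p) = ∑ x, w x * |f x - p x| := by
      rw [dist_eq_norm, ← map_sub, PiLp.norm_eq_of_L1]
      exact Finset.sum_congr rfl fun x _ => by
        rw [T_apply, Real.norm_eq_abs, abs_mul, abs_of_nonneg (hw x), Pi.sub_apply]
    have hφf' : φ (K.mkQ (T f)) = ‖K.mkQ (T f)‖ := hφf
    rw [← hd, ← hdist, ← hnorm, ← hφf', hsum]
    exact Finset.sum_congr rfl fun x _ => by rw [T_apply]; ring

/-- Weak duality between weighted `ℓ¹` approximation and orthogonal sign-bounded weights. -/
theorem weighted_correlation_le_l1_error {ι : Type*} [Fintype ι] {w f g p : ι → ℝ}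
    (hw : ∀ x, 0 ≤ w x) (hg : ∀ x, |g x| ≤ 1) (hgp : ∑ x, w x * (g x * p x) = 0) :
    ∑ x, w x * (f x * g x) ≤ ∑ x, w x * |f x - p x| := by
  calc ∑ x, w x * (f x * g x) = ∑ x, w x * ((f x - p x) * g x) := by
        rw [← sub_zero (∑ x, w x * (f x * g x)), ← hgp, ← Finset.sum_sub_distrib]
        exact Finset.sum_congr rfl fun x _ => by ring
    _ ≤ ∑ x, w x * |f x - p x| := by
        refine Finset.sum_le_sum fun x _ => mul_le_mul_of_nonneg_left ?_ (hw x)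
        calc (f x - p x) * g x ≤ |(f x - p x) * g x| := le_abs_self _
          _ = |f x - p x| * |g x| := abs_mul _ _
          _ ≤ |f x - p x| := mul_le_of_le_one_right (abs_nonneg _) (hg x)

theorem abs_sub_eq_one_sub_mul {a b : ℝ} (ha : a = 1 ∨ a = -1) (hb : |b| ≤ 1) :
    |a - b| = 1 - a * b := by
  obtain ⟨h₁, h₂⟩ := abs_le.mp hb
  rcases ha with rfl | rfl
  · rw [abs_of_nonneg (by linarith)]; ring
  · rw [abs_of_nonpos (by linarith)]; ring

theorem pexpect_one {X : Type*} [Fintype X] {n : ℕ} {π : Fin n → X → ℝ}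
    (hπ : ∀ i, ∑ x : X, π i x = 1) : pexpect π (fun _ => 1) = 1 := by
  classical
  simp only [pexpect, mul_one]
  rw [← Fintype.piFinset_univ, ← Finset.prod_univ_sum]
  simp [hπ]

theorem pexpect_abs_sub {X : Type*} [Fintype X] {n : ℕ} {π : Fin n → X → ℝ}
    (hπ : ∀ i, ∑ x : X, π i x = 1) {f g : (Fin n → X) → ℝ} (hf : ∀ x, f x = 1 ∨ f x = -1)
    (hg : ∀ x, |g x| ≤ 1) :
    pexpect π (fun x => |f x - g x|) = 1 - pexpect π (fun x => f x * g x) := by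
  rw [← pexpect_one hπ]
  simp only [pexpect, ← Finset.sum_sub_distrib, ← mul_sub]
  exact Finset.sum_congr rfl fun x _ => by rw [abs_sub_eq_one_sub_mul (hf x) (hg x)]

theorem pexpect_mul_eq_zero_of_mem_span {X : Type*} [Fintype X] {n : ℕ} {π : Fin n → X → ℝ}
    {g : (Fin n → X) → ℝ} {s : Set ((Fin n → X) → ℝ)}
    (hg : ∀ h ∈ s, pexpect π (fun x => g x * h x) = 0) {p : (Fin n → X) → ℝ}
    (hp : p ∈ Submodule.span ℝ s) : pexpect π (fun x => g x * p x) = 0 := by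
  induction hp using Submodule.span_induction with
  | mem h hh => exact hg h hh
  | zero => simp [pexpect]
  | add u v _ _ hu hv =>
    simp only [pexpect, Pi.add_apply, mul_add, Finset.sum_add_distrib] at hu hv ⊢
    rw [hu, hv, add_zero]
  | smul c u _ hu =>
    simp only [pexpect, Pi.smul_apply, smul_eq_mul, mul_left_comm _ c, ← Finset.mul_sum] at hu ⊢
    rw [hu, mul_zero]

/-- **Duality over product distributions.** Let `Π = Π₁ × ⋯ × Πₙ` be a product distribution on
`Xⁿ` (for a finite nonempty `X`), `f : Xⁿ → {-1,1}` and `0 ≤ d ≤ n`.  If `α` is the minimum of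
`E_{x∼Π}|f - g|` over all `g : Xⁿ → [-1,1]` that are `d`-resilient relative to `Π` (i.e.
uncorrelated with every function depending on at most `d` coordinates), then the minimum of
`E_{x∼Π}|f - p|` over `p` in the span `J_d` of the functions depending on at most `d`
coordinates exists and equals `1 - α`. -/
theorem stmt1 {X : Type*} [Fintype X] [DecidableEq X] [Nonempty X]
    (n d : ℕ) (hd : d ≤ n) (π : Fin n → X → ℝ)
    (hπ0 : ∀ i x, 0 ≤ π i x) (hπ1 : ∀ i, ∑ x : X, π i x = 1)
    (f : (Fin n → X) → ℝ) (hf : ∀ x, f x = 1 ∨ f x = -1)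
    (α : ℝ)
    (hα : IsLeast {β : ℝ | ∃ g : (Fin n → X) → ℝ,
        (∀ h : (Fin n → X) → ℝ, DependsOnAtMost d h →
            pexpect π (fun x => g x * h x) = 0) ∧
        (∀ x, |g x| ≤ 1) ∧ pexpect π (fun x => |f x - g x|) = β} α) :
    IsLeast {β : ℝ | ∃ p ∈ Submodule.span ℝ
        {h : (Fin n → X) → ℝ | DependsOnAtMost d h},
        pexpect π (fun x => |f x - p x|) = β} (1 - α) := by
  have hw (x : Fin n → X) : 0 ≤ ∏ i, π i (x i) := Finset.prod_nonneg fun i _ => hπ0 i (x i)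
  obtain ⟨p, hp, g, hg, hgJ, hpg⟩ := exists_weighted_l1_approx_dual
    (fun x : Fin n → X => ∏ i, π i (x i)) f hw (Submodule.span ℝ {h | DependsOnAtMost d h})
  obtain ⟨⟨g₀, hg₀res, hg₀, rfl⟩, hmin⟩ := hα
  have hle : pexpect π (fun x => |f x - g₀ x|) ≤ 1 - pexpect π (fun x => f x * g x) :=
    hmin ⟨g, fun h hh => hgJ h (Submodule.subset_span hh), hg, pexpect_abs_sub hπ1 hf hg⟩
  have hge : pexpect π (fun x => f x * g₀ x) ≤ pexpect π (fun x => |f x - p x|) :=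
    weighted_correlation_le_l1_error hw hg₀ (pexpect_mul_eq_zero_of_mem_span hg₀res hp)
  have hpg' : pexpect π (fun x => |f x - p x|) = pexpect π (fun x => f x * g x) := hpg
  rw [pexpect_abs_sub hπ1 hf hg₀] at hle ⊢
  have heq : 1 - (1 - pexpect π (fun x => f x * g₀ x)) = pexpect π (fun x => f x * g x) := by
    linarith
  rw [heq]
  refine ⟨⟨p, hp, hpg'⟩, ?_⟩
  rintro _ ⟨q, hq, rfl⟩
  exact weighted_correlation_le_l1_error hw hg (hgJ q hq)
end
end

section
/- For all integers 1 ≤ d ≤ k ≤ n there exists a family of m subsets S₁,…,S_m of {1,…,n}, each of cardinality exactly k, such that |S_i ∩ S_j| ≤ d for all i ≠ j, where m ≥ C(n,d)/C(k,d)² ≥ (nd/(e²k²))^d. (Here C(a,b) denotes the binomial coefficient.) -/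
open Finset

/-- At most `C(|α| - |D|, k - |D|)` sets of size `k` contain a given set `D`. -/
theorem card_powersetCard_filter_superset_le {α : Type*} [Fintype α] [DecidableEq α]
    (D : Finset α) (k : ℕ) :
    #{T ∈ powersetCard k (univ : Finset α) | D ⊆ T} ≤
      (Fintype.card α - #D).choose (k - #D) := by
  rw [← card_compl, ← card_powersetCard]
  refine card_le_card_of_injOn (· \ D) ?_ ?_
  · intro T hT
    simp only [mem_coe, mem_filter, mem_powersetCard] at hT
    simp only [mem_coe, mem_powersetCard]
    refine ⟨fun x hx => by simp_all, ?_⟩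
    rw [card_sdiff_of_subset hT.2, hT.1.2]
  · intro T hT U hU h
    simp only [mem_coe, mem_filter, mem_powersetCard] at hT hU
    rw [← sdiff_union_of_subset hT.2, ← sdiff_union_of_subset hU.2]
    exact congrArg (· ∪ D) h

/-- A maximal family of `k`-sets with pairwise intersections smaller than `d` meets every `k`-set
in at least `d` points. -/
theorem exists_design_forall_le_card_inter {α : Type*} [Fintype α] [DecidableEq α]
    {k d : ℕ} (hdk : d ≤ k) :
    ∃ 𝒮 : Finset (Finset α), (∀ S ∈ 𝒮, #S = k) ∧
      (∀ S ∈ 𝒮, ∀ T ∈ 𝒮, S ≠ T → #(S ∩ T) < d) ∧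
      ∀ T : Finset α, #T = k → ∃ S ∈ 𝒮, d ≤ #(S ∩ T) := by
  obtain ⟨𝒮, h𝒮⟩ := Set.Finite.exists_maximal
    (s := {𝒮 : Finset (Finset α) | (∀ S ∈ 𝒮, #S = k) ∧
      ∀ S ∈ 𝒮, ∀ T ∈ 𝒮, S ≠ T → #(S ∩ T) < d}) (Set.toFinite _) ⟨∅, by simp⟩
  refine ⟨𝒮, h𝒮.prop.1, h𝒮.prop.2, fun T hT => ?_⟩
  by_contra! hlt
  have hmem : T ∈ 𝒮 := by
    refine h𝒮.le_of_ge ⟨?_, ?_⟩ (subset_insert T 𝒮) (mem_insert_self T 𝒮)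
    · simpa [hT] using h𝒮.prop.1
    · intro A hA B hB hAB
      rw [mem_insert] at hA hB
      rcases hA with rfl | hA <;> rcases hB with rfl | hB
      · exact absurd rfl hAB
      · rw [inter_comm]
        exact hlt B hB
      · exact hlt A hA
      · exact h𝒮.prop.2 A hA B hB hAB
  have := hlt T hmem
  rw [inter_self, hT] at this
  omega

/-- If every `k`-set meets some member of a family `𝒮` of `k`-sets in at least `d` points, then
`C(n,d) ≤ |𝒮| C(k,d)²`. -/
theorem choose_le_card_mul_choose_sq {α : Type*} [Fintype α] [DecidableEq α] {k d : ℕ}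
    (hdk : d ≤ k) (hk : k ≤ Fintype.card α) {𝒮 : Finset (Finset α)} (h𝒮 : ∀ S ∈ 𝒮, #S = k)
    (hcover : ∀ T : Finset α, #T = k → ∃ S ∈ 𝒮, d ≤ #(S ∩ T)) :
    (Fintype.card α).choose d ≤ #𝒮 * k.choose d ^ 2 := by
  have hcount : (Fintype.card α).choose k ≤
      #𝒮 * (k.choose d * (Fintype.card α - d).choose (k - d)) := by
    have hsub : powersetCard k (univ : Finset α) ⊆ 𝒮.biUnion fun S =>
        (powersetCard d S).biUnion fun D => {T ∈ powersetCard k (univ : Finset α) | D ⊆ T} := by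
      intro T hT
      obtain ⟨S, hS, hST⟩ := hcover T (mem_powersetCard.1 hT).2
      obtain ⟨D, hD, hDcard⟩ := exists_subset_card_eq hST
      refine mem_biUnion.2 ⟨S, hS, mem_biUnion.2 ⟨D, ?_, ?_⟩⟩
      · exact mem_powersetCard.2 ⟨hD.trans inter_subset_left, hDcard⟩
      · exact mem_filter.2 ⟨hT, hD.trans inter_subset_right⟩
    rw [← card_univ, ← card_powersetCard, card_univ]
    refine (card_le_card hsub).trans (card_biUnion_le_card_mul _ _ _ fun S hS => ?_)
    rw [← h𝒮 S hS, ← card_powersetCard, h𝒮 S hS]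
    refine card_biUnion_le_card_mul _ _ _ fun D hD => ?_
    simpa [(mem_powersetCard.1 hD).2] using card_powersetCard_filter_superset_le D k
  have hpos : 0 < (Fintype.card α - d).choose (k - d) := Nat.choose_pos (by omega)
  refine Nat.le_of_mul_le_mul_right ?_ hpos
  calc (Fintype.card α).choose d * (Fintype.card α - d).choose (k - d)
      = (Fintype.card α).choose k * k.choose d := (Nat.choose_mul hdk).symm
    _ ≤ #𝒮 * (k.choose d * (Fintype.card α - d).choose (k - d)) * k.choose d := by gcongr
    _ = #𝒮 * k.choose d ^ 2 * (Fintype.card α - d).choose (k - d) := by ring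

theorem div_pow_le_choose {n d : ℕ} (hdn : d ≤ n) : ((n : ℝ) / d) ^ d ≤ n.choose d := by
  induction d generalizing n with
  | zero => simp
  | succ d ih =>
    obtain ⟨m, rfl⟩ : ∃ m, n = m + 1 := ⟨n - 1, by omega⟩
    have hdm : d ≤ m := by omega
    have hchoose : ((m + 1).choose (d + 1) : ℝ) =
        (m.choose d : ℝ) * (((m + 1 : ℕ) : ℝ) / (d + 1 : ℕ)) := by
      have h := Nat.add_one_mul_choose_eq m d
      rw [← mul_div_assoc, eq_div_iff (by positivity)]
      exact_mod_cast (by linarith : (m + 1).choose (d + 1) * (d + 1) = m.choose d * (m + 1))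
    rw [hchoose, pow_succ]
    gcongr
    refine le_trans ?_ (ih hdm)
    rcases Nat.eq_zero_or_pos d with rfl | hd
    · simp
    · gcongr ?_ ^ d
      rw [div_le_div_iff₀ (by positivity) (by positivity)]
      have : (d : ℝ) ≤ m := by exact_mod_cast hdm
      push_cast
      nlinarith

theorem choose_le_exp_mul_div_pow (k : ℕ) {d : ℕ} (hd : 1 ≤ d) :
    (k.choose d : ℝ) ≤ (Real.exp 1 * k / d) ^ d := by
  have hexp : (d : ℝ) ^ d / d.factorial ≤ Real.exp 1 ^ d := by
    rw [← Real.exp_nat_mul, mul_one]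
    exact Real.pow_div_factorial_le_exp _ d.cast_nonneg _
  calc (k.choose d : ℝ) ≤ (k : ℝ) ^ d / d.factorial := Nat.choose_le_pow_div d k
    _ = (d : ℝ) ^ d / d.factorial * ((k : ℝ) / d) ^ d := by
      rw [div_pow]
      field_simp
    _ ≤ Real.exp 1 ^ d * ((k : ℝ) / d) ^ d := by gcongr
    _ = (Real.exp 1 * k / d) ^ d := by rw [← mul_pow, mul_div_assoc]

/-- **Existence of large designs.** For all `1 ≤ d ≤ k ≤ n` there is an `(n,k,d)`-design of size
`m ≥ C(n,d)/C(k,d)² ≥ (nd/(e²k²))^d`: a family of `m` subsets of `{1,…,n}`, each of cardinality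
`k`, any two distinct members intersecting in at most `d` elements. -/
theorem stmt2 (n k d : ℕ) (hd : 1 ≤ d) (hdk : d ≤ k) (hkn : k ≤ n) :
    ∃ 𝒮 : Finset (Finset (Fin n)),
      (∀ S ∈ 𝒮, S.card = k) ∧
      (∀ S ∈ 𝒮, ∀ T ∈ 𝒮, S ≠ T → (S ∩ T).card ≤ d) ∧
      (n.choose d : ℝ) / (k.choose d : ℝ) ^ 2 ≤ (𝒮.card : ℝ) ∧
      ((n * d : ℝ) / (Real.exp 1 ^ 2 * (k : ℝ) ^ 2)) ^ d ≤
        (n.choose d : ℝ) / (k.choose d : ℝ) ^ 2 := by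
  obtain ⟨𝒮, hcard, hinter, hcover⟩ := exists_design_forall_le_card_inter (α := Fin n) hdk
  have hchoose : (0 : ℝ) < k.choose d := by exact_mod_cast Nat.choose_pos hdk
  refine ⟨𝒮, hcard, fun S hS T hT hST => (hinter S hS T hT hST).le, ?_, ?_⟩
  · rw [div_le_iff₀ (by positivity)]
    have h := choose_le_card_mul_choose_sq hdk (by simpa using hkn) hcard hcover
    rw [Fintype.card_fin] at h
    exact_mod_cast h
  · have hd0 : (0 : ℝ) < d := by exact_mod_cast hd
    have hk0 : (0 : ℝ) < k := by exact_mod_cast hd.trans hdk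
    calc ((n * d : ℝ) / (Real.exp 1 ^ 2 * (k : ℝ) ^ 2)) ^ d
        = ((n : ℝ) / d) ^ d / ((Real.exp 1 * k / d) ^ d) ^ 2 := by
          rw [← pow_mul, mul_comm d 2, pow_mul, ← div_pow]
          congr 1
          field_simp
      _ ≤ (n.choose d : ℝ) / (k.choose d : ℝ) ^ 2 := by
          gcongr
          · exact div_pow_le_choose (hdk.trans hkn)
          · exact choose_le_exp_mul_div_pow k hd
end

section
/- Let d ≥ 0 and let g : {-1,1}^k → ℝ be d-resilient. For a subset S ⊆ {1,…,n} with |S| = k, define g_S : {-1,1}^n → ℝ by g_S(x) = g(x|_S), where x|_S is the restriction of x to the coordinates in S listed in increasing order. Then for any two subsets S, T ⊆ {1,…,n} of size k with |S ∩ T| ≤ d, one has E_x[g_S(x) · g_T(x)] = 0, where x is uniform on {-1,1}^n. -/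
open Finset

noncomputable section

/-- A function orthogonal to every character `∏ i ∈ S, x_i` with `S ⊆ A` is orthogonal to every
function depending only on the coordinates in `A`. -/
lemma sum_mul_eq_zero_of_dependsOn {ι : Type*} [Fintype ι] [DecidableEq ι] (A : Finset ι)
    (g h : (ι → Bool) → ℝ) (hg : ∀ S ⊆ A, ∑ x, g x * ∏ i ∈ S, sgn (x i) = 0)
    (hh : ∀ x y : ι → Bool, (∀ i ∈ A, x i = y i) → h x = h y) :
    ∑ x, g x * h x = 0 := by
  induction A using Finset.induction_on generalizing g h with
  | empty =>
    have hconst : ∀ x, h x = h fun _ => true := fun x => hh _ _ (by simp)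
    have hsum : ∑ x, g x = 0 := by simpa using hg ∅ (Finset.Subset.refl _)
    simp_rw [hconst, ← Finset.sum_mul, hsum, zero_mul]
  | insert a A ha ih =>
    have hupd : ∀ (b : Bool) (x y : ι → Bool), (∀ i ∈ A, x i = y i) →
        h (Function.update x a b) = h (Function.update y a b) := by
      intro b x y hxy
      refine hh _ _ fun i hi => ?_
      by_cases hia : i = a
      · subst hia
        simp
      · simpa [hia] using hxy i (Finset.mem_of_mem_insert_of_ne hi hia)
    have heven := ih g
      (fun x => (h (Function.update x a true) + h (Function.update x a false)) / 2)
      (fun S hS => hg S (hS.trans (Finset.subset_insert a A)))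
      (fun x y hxy => by simp only [hupd _ x y hxy])
    have hodd := ih (fun x => g x * sgn (x a))
      (fun x => (h (Function.update x a true) - h (Function.update x a false)) / 2)
      (fun S hS => by
        have := hg (insert a S) (Finset.insert_subset_insert a hS)
        simpa [Finset.prod_insert (fun haS => ha (hS haS)), mul_assoc] using this)
      (fun x y hxy => by simp only [hupd _ x y hxy])
    rw [← add_zero (0 : ℝ)]
    nth_rewrite 1 [← heven]
    rw [← hodd, ← Finset.sum_add_distrib]
    refine Finset.sum_congr rfl fun x _ => ?_
    have hx : h x = h (Function.update x a (x a)) := by rw [Function.update_eq_self]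
    rw [hx]
    cases x a <;> simp only [sgn] <;> norm_num <;> ring

/-- A `d`-resilient function is orthogonal to every function of at most `d` coordinates. -/
lemma Resilient.sum_mul_eq_zero {ι : Type*} [Fintype ι] [DecidableEq ι] {d : ℕ}
    {g : (ι → Bool) → ℝ} (hg : Resilient d g) {A : Finset ι} (hA : A.card ≤ d)
    (h : (ι → Bool) → ℝ) (hh : ∀ x y : ι → Bool, (∀ i ∈ A, x i = y i) → h x = h y) :
    ∑ x, g x * h x = 0 := by
  refine sum_mul_eq_zero_of_dependsOn A g h (fun S hS => ?_) hh
  have hzero := hg S ((Finset.card_le_card hS).trans hA)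
  simpa [fcoef, _root_.expect] using hzero

/-- **Orthogonality of copies of a resilient function on almost-disjoint sets of variables.**
If `g : {-1,1}^k → ℝ` is `d`-resilient and `S, T ⊆ {1,…,n}` have cardinality `k` and
`|S ∩ T| ≤ d`, then the copies `g_S(x) = g(x|_S)` and `g_T(x) = g(x|_T)` (restriction listing
coordinates in increasing order) satisfy `E_x[g_S(x)·g_T(x)] = 0` for `x` uniform on
`{-1,1}^n`. -/
theorem stmt3 (n k d : ℕ) (g : (Fin k → Bool) → ℝ) (hg : Resilient d g)
    (S T : Finset (Fin n)) (hS : S.card = k) (hT : T.card = k)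
    (hST : (S ∩ T).card ≤ d) :
    expect (fun x : Fin n → Bool =>
      g (fun i => x (S.orderIsoOfFin hS i)) * g (fun i => x (T.orderIsoOfFin hT i))) = 0 := by
  have hA : (Finset.univ.filter fun i : Fin k => (S.orderIsoOfFin hS i : Fin n) ∈ T).card ≤ d := by
    refine le_trans (Finset.card_le_card_of_injOn
      (fun i => (S.orderIsoOfFin hS i : Fin n)) (fun i hi => ?_) ?_) hST
    · simpa using (Finset.mem_filter.mp hi).2
    · exact fun i _ j _ hij => (S.orderIsoOfFin hS).injective (Subtype.ext hij)
  rw [_root_.expect, div_eq_zero_iff]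
  left
  rw [← (Equiv.piEquivPiSubtypeProd (fun j => j ∈ S) fun _ => Bool).symm.sum_comp,
    Fintype.sum_prod_type_right]
  refine Finset.sum_eq_zero fun z _ => ?_
  rw [← ((S.orderIsoOfFin hS).toEquiv.arrowCongr (Equiv.refl Bool)).sum_comp]
  convert hg.sum_mul_eq_zero hA (fun y => g fun i =>
    (Equiv.piEquivPiSubtypeProd (fun j => j ∈ S) fun _ => Bool).symm
      ((S.orderIsoOfFin hS).toEquiv.arrowCongr (Equiv.refl Bool) y, z)
      (T.orderIsoOfFin hT i)) ?_ using 3 with y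
  · congr 1
    funext i
    simp [Equiv.piEquivPiSubtypeProd]
    exact congrArg y ((S.orderIsoOfFin hS).symm_apply_apply i)
  · intro x y hxy
    congr 1
    funext i
    by_cases hi : (T.orderIsoOfFin hT i : Fin n) ∈ S
    · have hmem : (S.orderIsoOfFin hS).symm ⟨_, hi⟩ ∈
          Finset.univ.filter fun i : Fin k => (S.orderIsoOfFin hS i : Fin n) ∈ T := by
        rw [Finset.mem_filter, OrderIso.apply_symm_apply]
        exact ⟨Finset.mem_univ _, (T.orderIsoOfFin hT i).2⟩
      simpa [Equiv.piEquivPiSubtypeProd, hi, -Finset.coe_orderIsoOfFin_apply] using hxy _ hmem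
    · simp [Equiv.piEquivPiSubtypeProd, hi, -Finset.coe_orderIsoOfFin_apply]
end
end

section
/- Let w ≥ 1, let s = ⌈(ln 2)·2^w⌉, and let n = sw. Then for every integer d with 1 ≤ d ≤ w, the Fourier weight of Tribes_{w,s} on levels at most d satisfies Σ_{S : |S| ≤ d} (Tribes_{w,s})^(S)² ≤ 2·(2 ln n)^{2d+4}/n. -/
open Finset

noncomputable section

/-- The `Tribes_{w,s}` function on `{-1,1}^{sw}` (coordinates indexed by `Fin s × Fin w`,
block `j` being `{(j,i) : i ∈ Fin w}`): the monotone read-once DNF which is `1` iff some block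
consists entirely of `1`s (`true`s), and `-1` otherwise. -/
def TribesFun (w s : ℕ) (x : Fin s × Fin w → Bool) : ℝ :=
  if ∃ j : Fin s, ∀ i : Fin w, x (j, i) = true then 1 else -1

/-- A finite subset of a product corresponds to the family of its fibres over the first factor. -/
def fibreEquiv (α β : Type*) [Fintype α] [DecidableEq α] [Fintype β] [DecidableEq β] :
    Finset (α × β) ≃ (α → Finset β) where
  toFun S j := univ.filter fun i => (j, i) ∈ S
  invFun F := univ.filter fun q => q.2 ∈ F q.1
  left_inv S := by ext ⟨j, i⟩; simp
  right_inv F := by ext j i; simp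

section Fibres

variable {α β : Type*} [Fintype α] [DecidableEq α] [Fintype β] [DecidableEq β]

lemma mem_fibreEquiv (S : Finset (α × β)) (j : α) (i : β) :
    i ∈ fibreEquiv α β S j ↔ (j, i) ∈ S := by
  simp [fibreEquiv]

lemma prod_eq_prod_fibreEquiv (S : Finset (α × β)) (f : α × β → ℝ) :
    ∏ q ∈ S, f q = ∏ j, ∏ i ∈ fibreEquiv α β S j, f (j, i) := by
  rw [Finset.prod_sigma']
  refine Finset.prod_bij' (fun q _ => ⟨q.1, q.2⟩) (fun q _ => (q.1, q.2)) ?_ ?_ ?_ ?_ ?_ <;>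
    simp [mem_fibreEquiv]

lemma eq_empty_iff_fibreEquiv (S : Finset (α × β)) :
    S = ∅ ↔ ∀ j, fibreEquiv α β S j = ∅ := by
  simp [Finset.eq_empty_iff_forall_notMem, mem_fibreEquiv]

lemma sum_prod_fibreEquiv (g : Finset β → ℝ) :
    ∑ S : Finset (α × β), ∏ j, g (fibreEquiv α β S j) = (∑ T, g T) ^ Fintype.card α := by
  rw [Equiv.sum_comp (fibreEquiv α β) (fun F => ∏ j, g (F j))]
  rw [← Fintype.prod_sum (fun (_ : α) T => g T)]
  simp

lemma expect_prod_blocks (h : α → (β → Bool) → ℝ) :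
    expect (fun x : α × β → Bool => ∏ j, h j (fun i => x (j, i))) = ∏ j, expect (h j) := by
  have key : ∑ x : α × β → Bool, ∏ j, h j (fun i => x (j, i)) = ∏ j, ∑ y, h j y := by
    rw [Fintype.prod_sum]
    exact Equiv.sum_comp (Equiv.curry α β Bool) (fun y => ∏ j, h j (y j))
  unfold _root_.expect
  rw [key, Finset.prod_div_distrib]
  simp [← pow_mul, mul_comm]

end Fibres

section Expectation

variable {ι : Type*} [Fintype ι] [DecidableEq ι]

lemma expect_character (T : Finset ι) :
    expect (fun x => ∏ i ∈ T, sgn (x i)) = if T = ∅ then 1 else 0 := by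
  have h : ∀ x : ι → Bool, ∏ i ∈ T, sgn (x i) = ∏ i, (if i ∈ T then sgn (x i) else 1) := by
    intro x
    simp
  have key : ∑ x : ι → Bool, ∏ i ∈ T, sgn (x i) = ∏ i : ι, (if i ∈ T then 0 else 2) := by
    simp_rw [h]
    rw [← Fintype.prod_sum (fun i b => if i ∈ T then sgn b else 1)]
    refine Finset.prod_congr rfl fun i _ => ?_
    by_cases hi : i ∈ T <;> simp [hi, sgn]
  unfold _root_.expect
  rw [key]
  split_ifs with hT
  · simp [hT]
  · obtain ⟨i, hi⟩ := Finset.nonempty_iff_ne_empty.mpr hT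
    rw [Finset.prod_eq_zero (Finset.mem_univ i) (by simp [hi])]
    simp

lemma expect_and_mul_character (T : Finset ι) :
    expect (fun x => (if ∀ i, x i = true then (1 : ℝ) else 0) * ∏ i ∈ T, sgn (x i))
      = (2 ^ Fintype.card ι)⁻¹ := by
  unfold _root_.expect
  rw [Finset.sum_eq_single (fun _ => true)]
  · simp [sgn]
  · intro x _ hx
    rw [if_neg (fun h => hx (funext h)), zero_mul]
  · simp

lemma expect_not_and_mul_character (T : Finset ι) :
    expect (fun x => (1 - if ∀ i, x i = true then (1 : ℝ) else 0) * ∏ i ∈ T, sgn (x i))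
      = (if T = ∅ then 1 else 0) - (2 ^ Fintype.card ι)⁻¹ := by
  rw [← expect_character T, ← expect_and_mul_character T, ← expect_sub]
  simp only [sub_mul, one_mul]

end Expectation

lemma tribesFun_eq (w s : ℕ) (x : Fin s × Fin w → Bool) :
    TribesFun w s x = 1 - 2 * ∏ j, (1 - if ∀ i, x (j, i) = true then (1 : ℝ) else 0) := by
  unfold TribesFun
  split_ifs with h
  · obtain ⟨j, hj⟩ := h
    rw [Finset.prod_eq_zero (Finset.mem_univ j) (by simp [hj])]
    simp
  · rw [Finset.prod_eq_one]
    · norm_num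
    · intro j _
      rw [if_neg (fun hj => h ⟨j, hj⟩), sub_zero]

lemma fcoef_tribesFun (w s : ℕ) (S : Finset (Fin s × Fin w)) :
    fcoef (TribesFun w s) S = (if S = ∅ then 1 else 0)
      - 2 * ∏ j, ((if fibreEquiv _ _ S j = ∅ then 1 else 0) - ((2 : ℝ) ^ w)⁻¹) := by
  have h : ∀ x : Fin s × Fin w → Bool, TribesFun w s x * ∏ q ∈ S, sgn (x q)
      = ∏ q ∈ S, sgn (x q) - 2 * ∏ j, ((1 - if ∀ i, x (j, i) = true then (1 : ℝ) else 0)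
        * ∏ i ∈ fibreEquiv _ _ S j, sgn (x (j, i))) := by
    intro x
    rw [tribesFun_eq, Finset.prod_mul_distrib,
      ← prod_eq_prod_fibreEquiv S (fun q => sgn (x q))]
    ring
  unfold fcoef
  simp_rw [h]
  rw [expect_sub, expect_const_mul, expect_character,
    expect_prod_blocks (fun j (y : Fin w → Bool) =>
      (1 - if ∀ i, y i = true then (1 : ℝ) else 0) * ∏ i ∈ fibreEquiv _ _ S j, sgn (y i))]
  congr 2
  refine Finset.prod_congr rfl fun j _ => ?_
  convert expect_not_and_mul_character (fibreEquiv _ _ S j)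
  exact (Fintype.card_fin w).symm

lemma fcoef_tribesFun_empty (w s : ℕ) :
    fcoef (TribesFun w s) ∅ = 1 - 2 * (1 - ((2 : ℝ) ^ w)⁻¹) ^ s := by
  have h := (eq_empty_iff_fibreEquiv (∅ : Finset (Fin s × Fin w))).mp rfl
  rw [fcoef_tribesFun]
  simp [h]

lemma inv_two_pow_le_one (w : ℕ) : ((2 : ℝ) ^ w)⁻¹ ≤ 1 :=
  inv_le_one_of_one_le₀ (one_le_pow₀ one_le_two)

lemma sq_fcoef_tribesFun_le (w s : ℕ) (S : Finset (Fin s × Fin w)) (hS : S ≠ ∅) :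
    fcoef (TribesFun w s) S ^ 2
      ≤ 4 * ∏ j, (if fibreEquiv _ _ S j = ∅ then 1 else (((2 : ℝ) ^ w)⁻¹) ^ 2) := by
  have hp : (0 : ℝ) < ((2 : ℝ) ^ w)⁻¹ := by positivity
  have hp1 := inv_two_pow_le_one w
  rw [fcoef_tribesFun, if_neg hS, zero_sub, neg_sq, mul_pow, ← Finset.prod_pow]
  norm_num only
  refine mul_le_mul_of_nonneg_left (Finset.prod_le_prod (fun j _ => sq_nonneg _) ?_) (by norm_num)
  intro j _
  split_ifs
  · nlinarith
  · simp

lemma sum_weighted_block (w : ℕ) (t p : ℝ) :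
    ∑ T : Finset (Fin w), t ^ T.card * (if T = ∅ then 1 else p ^ 2)
      = 1 + p ^ 2 * ((1 + t) ^ w - 1) := by
  have h := Fintype.sum_pow_mul_eq_add_pow (Fin w) t (1 : ℝ)
  simp only [one_pow, mul_one, Fintype.card_fin] at h
  have h2 : ∀ T : Finset (Fin w), t ^ T.card * (if T = ∅ then 1 else p ^ 2)
      = p ^ 2 * t ^ T.card + (if T = ∅ then 1 - p ^ 2 else 0) := by
    intro T
    split_ifs with hT
    · simp [hT]
    · ring
  simp_rw [h2]
  rw [Finset.sum_add_distrib, ← Finset.mul_sum, h]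
  simp
  ring

/-- The weight of Tribes on levels at most `d`, bounded through its noise stability at rate
`1 / w`. -/
lemma low_degree_weight_le (w s d : ℕ) (hw : 1 ≤ w) :
    ∑ S ∈ univ.filter (fun S : Finset (Fin s × Fin w) => S.card ≤ d),
        fcoef (TribesFun w s) S ^ 2
      ≤ (1 - 2 * (1 - ((2 : ℝ) ^ w)⁻¹) ^ s) ^ 2
        + 4 * (w : ℝ) ^ d
          * ((1 + (((2 : ℝ) ^ w)⁻¹) ^ 2 * ((1 + (w : ℝ)⁻¹) ^ w - 1)) ^ s - 1) := by
  set p : ℝ := ((2 : ℝ) ^ w)⁻¹ with hp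
  have hw1 : (1 : ℝ) ≤ w := by exact_mod_cast hw
  set W : Finset (Fin s × Fin w) → ℝ := fun S =>
    ∏ j, ((w : ℝ)⁻¹ ^ (fibreEquiv _ _ S j).card
      * (if fibreEquiv _ _ S j = ∅ then 1 else p ^ 2)) with hW
  have hWpos : ∀ S, 0 ≤ W S := fun S => Finset.prod_nonneg fun j _ => by
    split_ifs <;> positivity
  have hWsum : ∑ S, W S = (1 + p ^ 2 * ((1 + (w : ℝ)⁻¹) ^ w - 1)) ^ s := by
    rw [hW, sum_prod_fibreEquiv (fun T => (w : ℝ)⁻¹ ^ T.card * (if T = ∅ then 1 else p ^ 2)),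
      sum_weighted_block, Fintype.card_fin]
  have hWempty : W ∅ = 1 := by
    have h := (eq_empty_iff_fibreEquiv (∅ : Finset (Fin s × Fin w))).mp rfl
    simp [hW, h]
  have hle : ∀ S : Finset (Fin s × Fin w), S.card ≤ d → S ≠ ∅ →
      fcoef (TribesFun w s) S ^ 2 ≤ 4 * (w : ℝ) ^ d * W S := by
    intro S hd hS
    have hcard : ∏ j, (w : ℝ)⁻¹ ^ (fibreEquiv _ _ S j).card = (w : ℝ)⁻¹ ^ S.card := by
      have h := prod_eq_prod_fibreEquiv S (fun _ => (w : ℝ)⁻¹)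
      simp only [Finset.prod_const] at h
      exact h.symm
    have hone : 1 ≤ (w : ℝ) ^ d * (w : ℝ)⁻¹ ^ S.card := by
      rw [inv_pow, ← div_eq_mul_inv, one_le_div (by positivity)]
      exact pow_le_pow_right₀ hw1 hd
    have hQ : 0 ≤ ∏ j, (if fibreEquiv _ _ S j = ∅ then (1 : ℝ) else p ^ 2) :=
      Finset.prod_nonneg fun j _ => by split_ifs <;> positivity
    rw [hW]
    simp only
    rw [Finset.prod_mul_distrib, hcard]
    refine (sq_fcoef_tribesFun_le w s S hS).trans ?_
    nlinarith [mul_le_mul_of_nonneg_right hone hQ]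
  have hmem : (∅ : Finset (Fin s × Fin w)) ∈
      univ.filter (fun S : Finset (Fin s × Fin w) => S.card ≤ d) := by simp
  rw [← Finset.add_sum_erase _ _ hmem, fcoef_tribesFun_empty, ← hWsum,
    ← Finset.add_sum_erase univ W (Finset.mem_univ ∅), hWempty, add_sub_cancel_left,
    Finset.mul_sum]
  gcongr
  calc _ ≤ ∑ S ∈ (univ.filter (fun S : Finset (Fin s × Fin w) => S.card ≤ d)).erase ∅,
        4 * (w : ℝ) ^ d * W S := by
        refine Finset.sum_le_sum fun S hS => ?_
        simp only [Finset.mem_erase, Finset.mem_filter] at hS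
        exact hle S hS.2.2 hS.1
    _ ≤ _ := by
        refine Finset.sum_le_sum_of_subset_of_nonneg
          (Finset.erase_subset_erase _ (Finset.filter_subset _ _)) fun S _ _ => ?_
        have := hWpos S
        positivity

/-- The squared mean of Tribes is at most `8p`, where `p` is the probability that a block is all
ones. -/
lemma sq_mean_le (p : ℝ) (hp : 0 < p) (hp2 : p ≤ 1 / 2) (s : ℕ)
    (hs1 : Real.log 2 ≤ s * p) (hs2 : s * p ≤ Real.log 2 + p) :
    (1 - 2 * (1 - p) ^ s) ^ 2 ≤ 8 * p := by
  have hq : 0 < 1 - p := by linarith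
  have hpow : (1 - p) ^ s = Real.exp (s * Real.log (1 - p)) := by
    rw [Real.exp_nat_mul, Real.exp_log hq]
  have hhalf : Real.exp (-Real.log 2) = 1 / 2 := by
    rw [Real.exp_neg, Real.exp_log (by norm_num)]; norm_num
  have hup : (1 - p) ^ s ≤ 1 / 2 := by
    rw [hpow, ← hhalf, Real.exp_le_exp]
    have := Real.log_le_sub_one_of_pos hq
    have hs0 : (0 : ℝ) ≤ s := s.cast_nonneg
    nlinarith
  have hlow : 1 / 2 * (1 - 4 * p) ≤ (1 - p) ^ s := by
    have hlog := Real.one_sub_inv_le_log_of_pos hq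
    have hinv : (1 - p)⁻¹ ≤ 1 + p * (1 + 2 * p) := by
      rw [inv_le_iff_one_le_mul₀ hq]
      nlinarith [mul_nonneg (sq_nonneg p) (by linarith : 0 ≤ 1 - 2 * p)]
    have hl2 := Real.log_two_lt_d9
    have hbound : -Real.log 2 - 4 * p ≤ s * Real.log (1 - p) := by
      have hs0 : (0 : ℝ) ≤ s := s.cast_nonneg
      have h1 : (s : ℝ) * (-(p * (1 + 2 * p))) ≤ s * Real.log (1 - p) :=
        mul_le_mul_of_nonneg_left (by linarith) hs0
      have h2 : (s * p) * (1 + 2 * p) ≤ (Real.log 2 + p) * (1 + 2 * p) :=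
        mul_le_mul_of_nonneg_right hs2 (by linarith)
      nlinarith
    rw [hpow]
    calc 1 / 2 * (1 - 4 * p) ≤ 1 / 2 * Real.exp (-(4 * p)) := by
          have := Real.add_one_le_exp (-(4 * p))
          linarith
      _ = Real.exp (-Real.log 2 - 4 * p) := by
          rw [← hhalf, ← Real.exp_add]; congr 1
      _ ≤ _ := Real.exp_le_exp.mpr hbound
  nlinarith [mul_nonneg (by linarith : 0 ≤ 1 - 2 * (1 - p) ^ s)
    (by linarith : 0 ≤ 4 * p - (1 - 2 * (1 - p) ^ s))]

lemma exp_sub_one_le_two_mul {x : ℝ} (hx0 : 0 ≤ x) (hx1 : x ≤ 1) : Real.exp x - 1 ≤ 2 * x := by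
  have h := convexOn_exp.2 (Set.mem_univ 0) (Set.mem_univ 1) (sub_nonneg.mpr hx1) hx0
    (by ring)
  simp only [smul_eq_mul, mul_zero, mul_one, zero_add, Real.exp_zero] at h
  nlinarith [Real.exp_one_lt_d9]

lemma stability_le (w s : ℕ) (hw : 1 ≤ w) (p : ℝ) (hp : 0 < p) (hp2 : p ≤ 1 / 2)
    (hs : s * p ≤ 1) :
    (1 + p ^ 2 * ((1 + (w : ℝ)⁻¹) ^ w - 1)) ^ s - 1 ≤ 4 * p := by
  have hw0 : (0 : ℝ) < w := by exact_mod_cast hw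
  have he : (1 + (w : ℝ)⁻¹) ^ w - 1 ≤ 2 := by
    have h1 : (1 + (w : ℝ)⁻¹) ^ w ≤ Real.exp (w⁻¹) ^ w := by
      gcongr
      linarith [Real.add_one_le_exp ((w : ℝ)⁻¹)]
    rw [← Real.exp_nat_mul, mul_inv_cancel₀ hw0.ne'] at h1
    linarith [Real.exp_one_lt_d9]
  have h1 : (1 + p ^ 2 * ((1 + (w : ℝ)⁻¹) ^ w - 1)) ^ s ≤ Real.exp (p ^ 2 * 2) ^ s := by
    have hge : 1 ≤ (1 + (w : ℝ)⁻¹) ^ w := one_le_pow₀ (by simp)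
    refine pow_le_pow_left₀ (by nlinarith [sq_nonneg p]) ?_ s
    nlinarith [Real.add_one_le_exp (p ^ 2 * 2), sq_nonneg p]
  rw [← Real.exp_nat_mul] at h1
  have h2 : (s : ℝ) * (p ^ 2 * 2) ≤ 2 * p := by nlinarith
  have h3 := Real.exp_le_exp.mpr h2
  have h4 := exp_sub_one_le_two_mul (by linarith : 0 ≤ 2 * p) (by linarith)
  linarith

lemma ceil_log_two_mul_two : ⌈Real.log 2 * 2 ^ 1⌉₊ = 2 := by
  rw [Nat.ceil_eq_iff (by norm_num)]
  have h1 := Real.log_two_gt_d9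
  have h2 := Real.log_two_lt_d9
  constructor <;> norm_num <;> linarith

lemma half_le_log (w s : ℕ) (hw : 2 ≤ w) (hs : Real.log 2 * 2 ^ w ≤ s) :
    (w : ℝ) ≤ 2 * Real.log ((s * w : ℕ) : ℝ) := by
  have hl := Real.log_two_gt_d9
  have hw2 : (2 : ℝ) ≤ w := by exact_mod_cast hw
  have hpos : (0 : ℝ) < 2 ^ w := by positivity
  have h : (2 : ℝ) ^ w ≤ ((s * w : ℕ) : ℝ) := by
    push_cast
    nlinarith [mul_le_mul_of_nonneg_right hs (by linarith : (0 : ℝ) ≤ w)]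
  have h2 := Real.log_le_log hpos h
  rw [Real.log_pow] at h2
  nlinarith

/-- **Low-degree Fourier weight of Tribes.** For `w ≥ 1`, `s = ⌈(ln 2)·2^w⌉` and `n = sw`,
for every `1 ≤ d ≤ w`, the Fourier weight of `Tribes_{w,s}` on levels at most `d` is at most
`2·(2 ln n)^{2d+4}/n`. -/
theorem stmt5 (w : ℕ) (hw : 1 ≤ w) (s n : ℕ)
    (hs : s = ⌈Real.log 2 * 2 ^ w⌉₊) (hn : n = s * w)
    (d : ℕ) (hd1 : 1 ≤ d) (hdw : d ≤ w) :
    ∑ S ∈ Finset.univ.filter (fun S : Finset (Fin s × Fin w) => S.card ≤ d),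
        fcoef (TribesFun w s) S ^ 2
      ≤ 2 * (2 * Real.log n) ^ (2 * d + 4) / n := by
  subst hn
  refine (low_degree_weight_le w s d hw).trans ?_
  have hl1 := Real.log_two_gt_d9
  have hl2 := Real.log_two_lt_d9
  rcases hw.eq_or_lt with rfl | hw2
  · rw [ceil_log_two_mul_two] at hs
    obtain rfl : d = 1 := le_antisymm hdw hd1
    subst hs
    have h6 : (1.3 : ℝ) ^ 6 ≤ (2 * Real.log 2) ^ 6 :=
      pow_le_pow_left₀ (by norm_num) (by linarith) 6
    norm_num at h6 ⊢
    linarith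
  · have hlow : Real.log 2 * 2 ^ w ≤ s := hs ▸ Nat.le_ceil _
    have hpow : (0 : ℝ) < 2 ^ w := by positivity
    have hup : (s : ℝ) ≤ Real.log 2 * 2 ^ w + 1 :=
      hs ▸ (Nat.ceil_lt_add_one (by positivity)).le
    have hup' : (s : ℝ) ≤ 2 ^ w := by
      have : s ≤ 2 ^ w := by
        rw [hs, Nat.ceil_le]
        push_cast
        nlinarith
      exact_mod_cast this
    have hlog := half_le_log w s hw2 hlow
    set p : ℝ := ((2 : ℝ) ^ w)⁻¹ with hp
    have hp0 : 0 < p := by positivity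
    have hmul : (2 : ℝ) ^ w * p = 1 := mul_inv_cancel₀ hpow.ne'
    have hp2 : p ≤ 1 / 2 := by
      rw [hp, one_div]
      exact inv_anti₀ (by norm_num) (le_self_pow₀ (by norm_num) (by omega))
    have hs1 : Real.log 2 ≤ s * p := by nlinarith
    have hs2 : s * p ≤ Real.log 2 + p := by nlinarith
    have hs3 : s * p ≤ 1 := by nlinarith
    have hmean := sq_mean_le p hp0 hp2 s hs1 hs2
    have hstab := stability_le w s hw p hp0 hp2 hs3
    have hw2' : (2 : ℝ) ≤ w := by exact_mod_cast hw2
    have hw0 : (0 : ℝ) < w := by linarith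
    have hwd : 1 ≤ (w : ℝ) ^ d := one_le_pow₀ (by linarith)
    have hs0 : (0 : ℝ) < s := by nlinarith
    have h16 : (16 : ℝ) ≤ w ^ (d + 3) :=
      calc (16 : ℝ) = 2 ^ 4 := by norm_num
        _ ≤ w ^ 4 := pow_le_pow_left₀ (by norm_num) hw2' 4
        _ ≤ w ^ (d + 3) := pow_le_pow_right₀ (by linarith) (by omega)
    have hmain : 16 * (w : ℝ) ^ (d + 1) ≤ (2 * Real.log ((s * w : ℕ) : ℝ)) ^ (2 * d + 4) :=
      calc 16 * (w : ℝ) ^ (d + 1) ≤ w ^ (d + 3) * w ^ (d + 1) := by gcongr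
        _ = w ^ (2 * d + 4) := by rw [← pow_add]; congr 1; ring
        _ ≤ _ := pow_le_pow_left₀ hw0.le hlog _
    have hlhs : (1 - 2 * (1 - p) ^ s) ^ 2 + 4 * (w : ℝ) ^ d
        * ((1 + p ^ 2 * ((1 + (w : ℝ)⁻¹) ^ w - 1)) ^ s - 1) ≤ 24 * (w : ℝ) ^ d * p := by
      nlinarith [mul_le_mul_of_nonneg_left hstab (by positivity : 0 ≤ 4 * (w : ℝ) ^ d)]
    refine hlhs.trans ?_
    rw [le_div_iff₀ (by push_cast; positivity)]
    calc 24 * (w : ℝ) ^ d * p * ((s * w : ℕ) : ℝ) = 24 * (w : ℝ) ^ (d + 1) * (s * p) := by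
          push_cast; ring
      _ ≤ 24 * (w : ℝ) ^ (d + 1) * 1 := by gcongr
      _ ≤ _ := by nlinarith [pow_pos hw0 (d + 1)]
end
end

section
/- There exist universal constants c > 0 and n₀ such that for every n ≥ n₀ and every α ∈ (0,1), there exists a monotone Boolean function f : {-1,1}^n → {-1,1} that is α-approximately d-resilient, where d = ⌊c·α·√n / log n⌋. -/
open Finset

noncomputable section

open scoped BigOperators

theorem expect_eq_finset_expect {ι : Type*} [Fintype ι] [DecidableEq ι]
    (f : (ι → Bool) → ℝ) : _root_.expect f = 𝔼 x, f x := by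
  simp [_root_.expect, Fintype.expect_eq_sum_div_card]

theorem finset_expect_prod_fin {τ : Type*} [Fintype τ] (N : ℕ) (g : τ → ℝ) :
    𝔼 T : Fin N → τ, ∏ i, g (T i) = (𝔼 t, g t) ^ N := by
  rw [Finset.expect_pow, Fintype.piFinset_univ]

/-- Expectation of a product of functions of independent coordinates. -/
theorem finset_expect_prod_coord {ι : Type*} [Fintype ι] [DecidableEq ι] (g : ι → Bool → ℝ) :
    𝔼 x : ι → Bool, ∏ i, g i (x i) = ∏ i, ((g i false + g i true) / 2) := by
  rw [Fintype.expect_eq_sum_div_card, ← Fintype.piFinset_univ, ← Finset.prod_univ_sum,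
    Finset.prod_div_distrib]
  simp [add_comm]

theorem abs_pow_sub_pow_le_mul {a b : ℝ} (ha : |a| ≤ 1) (hb : |b| ≤ 1) (N : ℕ) :
    |a ^ N - b ^ N| ≤ N * |a - b| := by
  have h : max |a| |b| ^ (N - 1) ≤ 1 :=
    pow_le_one₀ (le_max_of_le_left (abs_nonneg a)) (max_le ha hb)
  calc |a ^ N - b ^ N| ≤ |a - b| * N * max |a| |b| ^ (N - 1) := abs_pow_sub_pow_le ..
    _ ≤ |a - b| * N * 1 := by gcongr
    _ = N * |a - b| := by ring

theorem finset_expect_sub_mul_sub {Ω : Type*} [Fintype Ω] [Nonempty Ω] (U V : Ω → ℝ) {a b : ℝ}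
    (hU : 𝔼 ω, U ω = a) (hV : 𝔼 ω, V ω = b) :
    𝔼 ω, (U ω - a) * (V ω - b) = 𝔼 ω, U ω * V ω - a * b := by
  have h : ∀ ω, (U ω - a) * (V ω - b) = U ω * V ω - U ω * b - a * V ω + a * b := by
    intro ω; ring
  simp only [h, Finset.expect_add_distrib, Finset.expect_sub_distrib, ← Finset.expect_mul,
    ← Finset.mul_expect, Fintype.expect_const, hU, hV]
  ring

/-- If `T` consists of `N` independent uniform elements of `τ` and `∏ i, (1 - u x (T i))` is
centred at its mean, then its correlation with a bounded function `ψ` has small second moment. -/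
theorem expect_sq_correlation_le {X τ : Type*} [Fintype X] [Fintype τ] [Nonempty X] [Nonempty τ]
    (u : X → τ → ℝ) (hu0 : ∀ x t, 0 ≤ u x t) (hu1 : ∀ x t, u x t ≤ 1)
    (ψ : X → ℝ) (hψ : ∀ x, |ψ x| ≤ 1) (N : ℕ) :
    𝔼 T : Fin N → τ,
      (𝔼 x, ψ x * (∏ i, (1 - u x (T i)) - (1 - 𝔼 t, u x t) ^ N)) ^ 2 ≤
      2 * N * 𝔼 t, (𝔼 x, u x t) ^ 2 := by
  have hmean : ∀ x, 𝔼 T : Fin N → τ, ∏ i, (1 - u x (T i)) = (1 - 𝔼 t, u x t) ^ N := by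
    intro x
    rw [finset_expect_prod_fin N (fun t => 1 - u x t), Finset.expect_sub_distrib,
      Fintype.expect_const]
  have hp0 : ∀ x, 0 ≤ 𝔼 t, u x t := fun x => Finset.expect_nonneg fun t _ => hu0 x t
  have hp1 : ∀ x, 𝔼 t, u x t ≤ 1 := fun x =>
    Finset.expect_le univ_nonempty fun t _ => hu1 x t
  have hcov : ∀ x y, |𝔼 T : Fin N → τ,
      ((∏ i, (1 - u x (T i)) - (1 - 𝔼 t, u x t) ^ N) *
        (∏ i, (1 - u y (T i)) - (1 - 𝔼 t, u y t) ^ N))| ≤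
      N * (𝔼 t, u x t * u y t + (𝔼 t, u x t) * 𝔼 t, u y t) := by
    intro x y
    have hq : 0 ≤ 𝔼 t, u x t * u y t :=
      Finset.expect_nonneg fun t _ => mul_nonneg (hu0 x t) (hu0 y t)
    have hprod : 𝔼 t, (1 - u x t) * (1 - u y t) =
        1 - (𝔼 t, u x t) - (𝔼 t, u y t) + 𝔼 t, u x t * u y t := by
      have : ∀ t, (1 - u x t) * (1 - u y t) = 1 - u x t - u y t + u x t * u y t := by
        intro t; ring
      simp only [this, Finset.expect_add_distrib, Finset.expect_sub_distrib, Fintype.expect_const]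
    have h1 : 𝔼 T : Fin N → τ,
        ((∏ i, (1 - u x (T i)) - (1 - 𝔼 t, u x t) ^ N) *
          (∏ i, (1 - u y (T i)) - (1 - 𝔼 t, u y t) ^ N)) =
        (𝔼 t, (1 - u x t) * (1 - u y t)) ^ N -
          ((1 - 𝔼 t, u x t) * (1 - 𝔼 t, u y t)) ^ N := by
      rw [← finset_expect_prod_fin N (fun t => (1 - u x t) * (1 - u y t)), mul_pow,
        finset_expect_sub_mul_sub _ _ (hmean x) (hmean y)]
      simp only [Finset.prod_mul_distrib]
    rw [h1]
    have ha : |𝔼 t, (1 - u x t) * (1 - u y t)| ≤ 1 := by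
      refine (Finset.abs_expect_le ..).trans (Finset.expect_le univ_nonempty fun t _ => ?_)
      rw [abs_of_nonneg (mul_nonneg (by linarith [hu1 x t]) (by linarith [hu1 y t]))]
      exact mul_le_one₀ (by linarith [hu0 x t]) (by linarith [hu1 y t]) (by linarith [hu0 y t])
    have hb : |(1 - 𝔼 t, u x t) * (1 - 𝔼 t, u y t)| ≤ 1 := by
      rw [abs_of_nonneg (mul_nonneg (by linarith [hp1 x]) (by linarith [hp1 y]))]
      exact mul_le_one₀ (by linarith [hp0 x]) (by linarith [hp1 y]) (by linarith [hp0 y])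
    refine (abs_pow_sub_pow_le_mul ha hb N).trans ?_
    gcongr
    rw [hprod]
    have := mul_nonneg (hp0 x) (hp0 y)
    rw [abs_le]; constructor <;> nlinarith
  have hmix : (𝔼 x, 𝔼 t, u x t) ^ 2 ≤ 𝔼 t, (𝔼 x, u x t) ^ 2 := by
    rw [Finset.expect_comm]
    simpa using Finset.expect_mul_sq_le_sq_mul_sq univ (fun t => 𝔼 x, u x t) (fun _ => 1)
  have hdiag : 𝔼 x, 𝔼 y, 𝔼 t, u x t * u y t = 𝔼 t, (𝔼 x, u x t) ^ 2 := by
    simp only [sq, Fintype.expect_mul_expect]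
    rw [Finset.expect_comm univ univ (fun t x => 𝔼 y, u x t * u y t)]
    exact Finset.expect_congr rfl fun x _ => Finset.expect_comm ..
  calc 𝔼 T : Fin N → τ,
      (𝔼 x, ψ x * (∏ i, (1 - u x (T i)) - (1 - 𝔼 t, u x t) ^ N)) ^ 2
      = 𝔼 x, 𝔼 y, ψ x * ψ y * 𝔼 T : Fin N → τ,
      ((∏ i, (1 - u x (T i)) - (1 - 𝔼 t, u x t) ^ N) *
        (∏ i, (1 - u y (T i)) - (1 - 𝔼 t, u y t) ^ N)) := by
        simp only [sq, Fintype.expect_mul_expect]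
        rw [Finset.expect_comm]
        refine Finset.expect_congr rfl fun x _ => ?_
        rw [Finset.expect_comm]
        refine Finset.expect_congr rfl fun y _ => ?_
        rw [Finset.mul_expect]
        refine Finset.expect_congr rfl fun T _ => ?_
        ring
    _ ≤ 𝔼 x, 𝔼 y, N * (𝔼 t, u x t * u y t + (𝔼 t, u x t) * 𝔼 t, u y t) := by
        refine Finset.expect_le_expect fun x _ => Finset.expect_le_expect fun y _ => ?_
        refine (le_abs_self _).trans ?_
        rw [abs_mul, abs_mul]
        refine (mul_le_of_le_one_left (abs_nonneg _) ?_).trans (hcov x y)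
        exact mul_le_one₀ (hψ x) (abs_nonneg _) (hψ y)
    _ = N * (𝔼 t, (𝔼 x, u x t) ^ 2 + (𝔼 x, 𝔼 t, u x t) ^ 2) := by
        simp only [← Finset.mul_expect, Finset.expect_add_distrib, hdiag, sq,
          ← Finset.expect_mul]
    _ ≤ 2 * N * 𝔼 t, (𝔼 x, u x t) ^ 2 := by
        have : (0 : ℝ) ≤ N := Nat.cast_nonneg N
        nlinarith

/-- The indicator that the conjunction of the variables listed by `t` is satisfied by `x`. -/
def conj {n w : ℕ} (x : Fin n → Bool) (t : Fin w → Fin n) : ℝ := ∏ j, if x (t j) then 1 else 0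

theorem conj_nonneg {n w : ℕ} (x : Fin n → Bool) (t : Fin w → Fin n) : 0 ≤ conj x t :=
  Finset.prod_nonneg fun j _ => by split_ifs <;> norm_num

theorem conj_le_one {n w : ℕ} (x : Fin n → Bool) (t : Fin w → Fin n) : conj x t ≤ 1 :=
  Finset.prod_le_one (fun j _ => by split_ifs <;> norm_num) fun j _ => by split_ifs <;> norm_num

theorem conj_eq_zero_or_one {n w : ℕ} (x : Fin n → Bool) (t : Fin w → Fin n) :
    conj x t = 0 ∨ conj x t = 1 := by
  by_cases h : ∀ j, x (t j) = true
  · right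
    simp [conj, h]
  · left
    push Not at h
    obtain ⟨j, hj⟩ := h
    exact Finset.prod_eq_zero (mem_univ j) (by simp [hj])

theorem conj_mono {n w : ℕ} (t : Fin w → Fin n) : Monotone fun x : Fin n → Bool => conj x t := by
  intro x y hxy
  refine Finset.prod_le_prod (fun j _ => by split_ifs <;> norm_num) fun j _ => ?_
  have := Bool.le_iff_imp.1 (hxy (t j))
  split_ifs <;> simp_all

theorem expect_conj_left {n w : ℕ} (t : Fin w → Fin n) :
    𝔼 x : Fin n → Bool, conj x t = (1 / 2) ^ #(univ.image t) := by
  have h : ∀ x : Fin n → Bool, conj x t =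
      ∏ i, if i ∈ univ.image t then (if x i then (1 : ℝ) else 0) else 1 := by
    intro x
    rw [Finset.prod_ite_mem, univ_inter]
    by_cases h : ∀ j, x (t j) = true
    · rw [Finset.prod_eq_one, conj, Finset.prod_eq_one]
      · simp [h]
      · intro i hi
        obtain ⟨j, -, rfl⟩ := Finset.mem_image.1 hi
        simp [h]
    · push Not at h
      obtain ⟨j, hj⟩ := h
      rw [conj, Finset.prod_eq_zero (mem_univ j) (by simp [hj]),
        Finset.prod_eq_zero (mem_image_of_mem t (mem_univ j)) (by simp [hj])]
  simp only [h]
  rw [finset_expect_prod_coord fun i b =>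
    if i ∈ univ.image t then (if b then (1 : ℝ) else 0) else 1]
  have h2 : ∀ i, ((if i ∈ univ.image t then (if false = true then (1 : ℝ) else 0) else 1) +
      (if i ∈ univ.image t then (if true = true then (1 : ℝ) else 0) else 1)) / 2 =
      if i ∈ univ.image t then 1 / 2 else 1 := by
    intro i; split_ifs <;> simp_all
  rw [Finset.prod_congr rfl fun i _ => h2 i, Finset.prod_ite_mem, univ_inter, Finset.prod_const]

theorem expect_conj_right {n w : ℕ} (x : Fin n → Bool) :
    𝔼 t : Fin w → Fin n, conj x t = (𝔼 i, if x i then (1 : ℝ) else 0) ^ w :=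
  finset_expect_prod_fin w fun i => if x i then (1 : ℝ) else 0

/-- A random sequence of `w` elements of `Fin n` rarely has many repetitions. -/
theorem expect_pow_card_image_le {n : ℕ} (hn : 0 < n) {w m : ℕ} (hw : w ≤ m)
    (hm : 12 * m ≤ n) :
    𝔼 t : Fin w → Fin n, (1 / 4 : ℝ) ^ #(univ.image t) ≤ (1 / 3) ^ w := by
  have : Nonempty (Fin n) := ⟨⟨0, hn⟩⟩
  have hn' : (0 : ℝ) < n := by exact_mod_cast hn
  induction w with
  | zero => simp
  | succ w ih =>
    have hstep : ∀ t : Fin w → Fin n,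
        𝔼 i, (1 / 4 : ℝ) ^ #(univ.image (Fin.cons i t : Fin (w + 1) → Fin n)) ≤
        (1 / 4) ^ #(univ.image t) * (1 / 3) := by
      intro t
      have himg : ∀ i, univ.image (Fin.cons i t : Fin (w + 1) → Fin n) =
          insert i (univ.image t) := by
        intro i
        ext k
        simp [Fin.exists_fin_succ, eq_comm]
      have hle : ∀ i, (1 / 4 : ℝ) ^ #(univ.image (Fin.cons i t : Fin (w + 1) → Fin n)) ≤
          (1 / 4) ^ #(univ.image t) * (1 / 4 + if i ∈ univ.image t then 1 else 0) := by
        intro i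
        rw [himg]
        by_cases hi : i ∈ univ.image t
        · rw [Finset.insert_eq_of_mem hi, if_pos hi]
          have : (0 : ℝ) ≤ (1 / 4) ^ #(univ.image t) := by positivity
          linarith
        · rw [Finset.card_insert_of_notMem hi, if_neg hi, pow_succ, add_zero]
      refine (Finset.expect_le_expect fun i _ => hle i).trans ?_
      rw [← Finset.mul_expect, Finset.expect_add_distrib, Fintype.expect_const]
      gcongr
      rw [Fintype.expect_eq_sum_div_card, Finset.sum_boole, Fintype.card_fin]
      have hc : #{x | x ∈ univ.image t} ≤ m := by
        rw [Finset.filter_univ_mem]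
        refine Finset.card_image_le.trans ?_
        simp; omega
      have : (#{x | x ∈ univ.image t} : ℝ) / n ≤ 1 / 12 := by
        rw [div_le_iff₀ hn']
        have h1 : (#{x | x ∈ univ.image t} : ℝ) ≤ m := by exact_mod_cast hc
        have h2 : (12 * m : ℝ) ≤ n := by exact_mod_cast hm
        linarith
      linarith
    calc 𝔼 t : Fin (w + 1) → Fin n, (1 / 4 : ℝ) ^ #(univ.image t)
        = 𝔼 p : Fin n × (Fin w → Fin n),
            (1 / 4 : ℝ) ^ #(univ.image (Fin.cons p.1 p.2 : Fin (w + 1) → Fin n)) :=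
          (Fintype.expect_equiv (Fin.consEquiv fun _ => Fin n) _ _ fun p => rfl).symm
      _ = 𝔼 t : Fin w → Fin n, 𝔼 i,
            (1 / 4 : ℝ) ^ #(univ.image (Fin.cons i t : Fin (w + 1) → Fin n)) := by
          rw [← Finset.univ_product_univ, Finset.expect_product, Finset.expect_comm]
      _ ≤ 𝔼 t : Fin w → Fin n, (1 / 4) ^ #(univ.image t) * (1 / 3) :=
          Finset.expect_le_expect fun t _ => hstep t
      _ ≤ (1 / 3) ^ (w + 1) := by
          rw [← Finset.expect_mul, pow_succ]
          gcongr
          exact ih (by omega)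

theorem expect_sq_expect_conj_le {n w : ℕ} (hn : 0 < n) (hw : 12 * w ≤ n) :
    𝔼 t : Fin w → Fin n, (𝔼 x : Fin n → Bool, conj x t) ^ 2 ≤ (1 / 3) ^ w := by
  refine le_trans (le_of_eq ?_) (expect_pow_card_image_le hn le_rfl hw)
  refine Finset.expect_congr rfl fun t _ => ?_
  rw [expect_conj_left, ← pow_mul, mul_comm, pow_mul]
  norm_num

/-- The parity of the coordinates of `x` in `S`. -/
def parity {n : ℕ} (S : Finset (Fin n)) (x : Fin n → Bool) : ℝ := ∏ i ∈ S, sgn (x i)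

theorem abs_sgn (b : Bool) : |sgn b| = 1 := by cases b <;> simp [sgn]

theorem abs_parity {n : ℕ} (S : Finset (Fin n)) (x : Fin n → Bool) : |parity S x| = 1 := by
  simp [parity, Finset.abs_prod, abs_sgn]

theorem expect_parity_mul_parity {n : ℕ} (S S' : Finset (Fin n)) :
    𝔼 x, parity S x * parity S' x = if S = S' then 1 else 0 := by
  have h : ∀ x, parity S x * parity S' x =
      ∏ i, ((if i ∈ S then sgn (x i) else 1) * (if i ∈ S' then sgn (x i) else 1)) := by
    intro x
    rw [Finset.prod_mul_distrib, Finset.prod_ite_mem, Finset.prod_ite_mem, univ_inter, univ_inter]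
    rfl
  simp only [h]
  rw [finset_expect_prod_coord fun i b =>
    (if i ∈ S then sgn b else 1) * (if i ∈ S' then sgn b else 1)]
  split_ifs with hS
  · subst hS
    refine Finset.prod_eq_one fun i _ => ?_
    split_ifs <;> norm_num [sgn]
  · obtain ⟨i, hi⟩ : ∃ i, ¬ (i ∈ S ↔ i ∈ S') := by
      by_contra! hc
      exact hS (Finset.ext hc)
    refine Finset.prod_eq_zero (mem_univ i) ?_
    by_cases h1 : i ∈ S <;> by_cases h2 : i ∈ S' <;> simp_all [sgn]

theorem expect_abs_bias_le {n : ℕ} (hn : 0 < n) :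
    𝔼 x : Fin n → Bool, |𝔼 i, sgn (x i)| ≤ 1 / √n := by
  have : Nonempty (Fin n) := ⟨⟨0, hn⟩⟩
  have hpar : ∀ i j : Fin n, 𝔼 x : Fin n → Bool, sgn (x i) * sgn (x j) = if i = j then 1 else 0 := by
    intro i j
    simpa [parity] using expect_parity_mul_parity {i} {j}
  have hsq : 𝔼 x : Fin n → Bool, (𝔼 i, sgn (x i)) ^ 2 = 1 / n := by
    simp only [sq, Fintype.expect_mul_expect]
    rw [Finset.expect_comm]
    have : ∀ i : Fin n, 𝔼 x : Fin n → Bool, 𝔼 j, sgn (x i) * sgn (x j) = 1 / n := by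
      intro i
      rw [Finset.expect_comm]
      simp [hpar]
    simp only [this, Fintype.expect_const]
  have hcs := Finset.expect_mul_sq_le_sq_mul_sq univ
    (fun x : Fin n → Bool => |𝔼 i, sgn (x i)|) (fun _ => 1)
  simp only [mul_one, sq_abs, hsq, one_pow, Fintype.expect_const] at hcs
  rw [← Real.sqrt_one, ← Real.sqrt_div zero_le_one]
  exact Real.le_sqrt_of_sq_le hcs

theorem fcoef_eq_expect_parity {n : ℕ} (g : (Fin n → Bool) → ℝ) (S : Finset (Fin n)) :
    fcoef g S = 𝔼 x, g x * parity S x := by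
  rw [fcoef, expect_eq_finset_expect]
  rfl

/-- A bounded function whose low-degree Fourier coefficients are small can be corrected to a
bounded resilient function. -/
theorem approxResilient_of_sum_abs_fcoef {n : ℕ} (f g : (Fin n → Bool) → ℝ) (hg : IsBounded g)
    (d : ℕ) :
    ApproxResilient
      (𝔼 x, |f x - g x| + 2 * ∑ S : Finset (Fin n) with #S ≤ d, |fcoef g S|) d f := by
  set ε := ∑ S : Finset (Fin n) with #S ≤ d, |fcoef g S| with hε
  have hε0 : 0 ≤ ε := Finset.sum_nonneg fun S _ => abs_nonneg _
  set h : (Fin n → Bool) → ℝ := fun x =>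
    ∑ S : Finset (Fin n) with #S ≤ d, fcoef g S * parity S x with hh
  have hhε : ∀ x, |h x| ≤ ε := by
    intro x
    refine (Finset.abs_sum_le_sum_abs ..).trans (le_of_eq ?_)
    exact Finset.sum_congr rfl fun S _ => by rw [abs_mul, abs_parity, mul_one]
  refine ⟨fun x => (g x - h x) / (1 + ε), ?_, ?_, ?_⟩
  · intro S hS
    have hcoef : 𝔼 x, h x * parity S x = fcoef g S := by
      simp only [hh, Finset.sum_mul]
      rw [Finset.expect_sum_comm]
      simp only [mul_assoc, ← Finset.mul_expect, expect_parity_mul_parity]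
      simp [hS]
    rw [fcoef_eq_expect_parity]
    have : ∀ x, (g x - h x) / (1 + ε) * parity S x =
        (g x * parity S x - h x * parity S x) / (1 + ε) := by
      intro x; ring
    simp only [this, ← Finset.expect_div, Finset.expect_sub_distrib, hcoef,
      ← fcoef_eq_expect_parity, sub_self, zero_div]
  · intro x
    rw [abs_div, abs_of_pos (by linarith : 0 < 1 + ε), div_le_one (by linarith)]
    exact (abs_sub _ _).trans (add_le_add (hg x) (hhε x))
  · rw [expect_eq_finset_expect]
    calc 𝔼 x, |f x - (g x - h x) / (1 + ε)| ≤ 𝔼 x, (|f x - g x| + 2 * ε) := by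
          refine Finset.expect_le_expect fun x _ => ?_
          have h1 : f x - (g x - h x) / (1 + ε) =
              (f x - g x) + (ε * g x + h x) / (1 + ε) := by
            field_simp
            ring
          rw [h1]
          refine (abs_add_le _ _).trans ?_
          gcongr
          rw [abs_div, abs_of_pos (by linarith : 0 < 1 + ε), div_le_iff₀ (by linarith)]
          have h2 : |ε * g x + h x| ≤ ε + ε := by
            refine (abs_add_le _ _).trans (add_le_add ?_ (hhε x))
            rw [abs_mul, abs_of_nonneg hε0]
            exact mul_le_of_le_one_right hε0 (hg x)
          nlinarith
      _ = _ := by rw [Finset.expect_add_distrib, Fintype.expect_const]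

/-- The `±1`-valued monotone DNF with terms `T i`. -/
def dnf {n N w : ℕ} (T : Fin N → Fin w → Fin n) (x : Fin n → Bool) : ℝ :=
  1 - 2 * ∏ i, (1 - conj x (T i))

theorem dnf_isBooleanValued {n N w : ℕ} (T : Fin N → Fin w → Fin n) :
    IsBooleanValued (dnf T) := by
  intro x
  by_cases h : ∀ i, conj x (T i) = 0
  · right; norm_num [dnf, h]
  · left
    push Not at h
    obtain ⟨i, hi⟩ := h
    have h1 : conj x (T i) = 1 := (conj_eq_zero_or_one x (T i)).resolve_left hi
    rw [dnf, Finset.prod_eq_zero (mem_univ i) (by rw [h1, sub_self])]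
    norm_num

theorem dnf_monotone {n N w : ℕ} (T : Fin N → Fin w → Fin n) : Monotone (dnf T) := by
  intro x y hxy
  have : ∏ i, (1 - conj y (T i)) ≤ ∏ i, (1 - conj x (T i)) :=
    Finset.prod_le_prod (fun i _ => by linarith [conj_le_one y (T i)]) fun i _ => by
      have : conj x (T i) ≤ conj y (T i) := conj_mono (T i) hxy
      linarith
  simp only [dnf]
  linarith

/-- The mean at `x` of a DNF with `N` uniformly random terms of width `w`. -/
def dnfMean {n : ℕ} (N w : ℕ) (x : Fin n → Bool) : ℝ :=
  1 - 2 * (1 - (𝔼 i, if x i then (1 : ℝ) else 0) ^ w) ^ N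

theorem exists_dnf_approxResilient {n w : ℕ} (hn : 0 < n) (hw : 12 * w ≤ n) (N d : ℕ) :
    ∃ T : Fin N → Fin w → Fin n, ApproxResilient
      (2 * 𝔼 x : Fin n → Bool, |dnfMean N w x| +
        4 * (#{S : Finset (Fin n) | #S ≤ d} * √(2 * N * (1 / 3) ^ w))) d (dnf T) := by
  have : Nonempty (Fin n) := ⟨⟨0, hn⟩⟩
  set μ : (Fin n → Bool) → ℝ := dnfMean N w with hμ
  set P : Finset (Finset (Fin n)) := {S : Finset (Fin n) | #S ≤ d} with hP
  set V : ℝ := 2 * N * (1 / 3) ^ w with hV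
  have hpos : ∀ x, 0 < 1 + |μ x| := fun x => by positivity
  set D : Finset (Fin n) → (Fin N → Fin w → Fin n) → ℝ := fun S T =>
    𝔼 x, parity S x / (1 + |μ x|) * (∏ i, (1 - conj x (T i)) - (1 - 𝔼 t, conj x t) ^ N) with hD
  have hsecond : ∀ S, 𝔼 T, D S T ^ 2 ≤ V := by
    intro S
    refine (expect_sq_correlation_le conj conj_nonneg conj_le_one _ (fun x => ?_) N).trans ?_
    · rw [abs_div, abs_parity, abs_of_pos (hpos x), div_le_one (hpos x)]
      linarith [abs_nonneg (μ x)]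
    · rw [hV]
      gcongr
      exact expect_sq_expect_conj_le hn hw
  obtain ⟨T, -, hT⟩ : ∃ T ∈ univ, ∑ S ∈ P, D S T ^ 2 ≤ #P * V := by
    refine Finset.exists_le_of_expect_le univ_nonempty ?_
    rw [Finset.expect_sum_comm, ← nsmul_eq_mul]
    exact Finset.sum_le_card_nsmul _ _ _ fun S _ => hsecond S
  have hsum : ∑ S ∈ P, |D S T| ≤ #P * √V := by
    have h1 : (∑ S ∈ P, |D S T|) ^ 2 ≤ (#P * √V) ^ 2 := by
      rw [mul_pow, Real.sq_sqrt (by positivity)]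
      refine sq_sum_le_card_mul_sum_sq.trans ?_
      simp only [sq_abs]
      rw [sq, mul_assoc]
      gcongr
    exact (sq_le_sq₀ (Finset.sum_nonneg fun S _ => abs_nonneg _) (by positivity)).1 h1
  refine ⟨T, ?_⟩
  set g : (Fin n → Bool) → ℝ := fun x => (dnf T x - μ x) / (1 + |μ x|) with hg
  have habs : ∀ x, |dnf T x| = 1 := by
    intro x
    rcases dnf_isBooleanValued T x with h | h <;> simp [h]
  have hgb : IsBounded g := by
    intro x
    rw [hg, abs_div, abs_of_pos (hpos x), div_le_one (hpos x), ← habs x]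
    exact abs_sub _ _
  have hcoef : ∀ S, |fcoef g S| = 2 * |D S T| := by
    intro S
    have : fcoef g S = -2 * D S T := by
      rw [fcoef_eq_expect_parity, hD, Finset.mul_expect]
      refine Finset.expect_congr rfl fun x _ => ?_
      rw [expect_conj_right]
      simp only [hg, hμ, dnf, dnfMean]
      ring
    rw [this, abs_mul]
    norm_num
  have hdist : 𝔼 x, |dnf T x - g x| ≤ 2 * 𝔼 x, |μ x| := by
    rw [Finset.mul_expect]
    refine Finset.expect_le_expect fun x _ => ?_
    have h1 : dnf T x - g x = (dnf T x * |μ x| + μ x) / (1 + |μ x|) := by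
      have := (hpos x).ne'
      simp only [hg]
      field_simp
      ring
    rw [h1, abs_div, abs_of_pos (hpos x), div_le_iff₀ (hpos x)]
    refine (abs_add_le _ _).trans ?_
    rw [abs_mul, habs, abs_abs]
    nlinarith [abs_nonneg (μ x)]
  obtain ⟨g', h1, h2, h3⟩ := approxResilient_of_sum_abs_fcoef (dnf T) g hgb d
  refine ⟨g', h1, h2, h3.trans ?_⟩
  simp only [hcoef, ← Finset.mul_sum]
  linarith

theorem exists_pow_near_half (w : ℕ) :
    ∃ N : ℕ, N ≤ 2 ^ w ∧ |1 - 2 * (1 - (1 / 2 : ℝ) ^ w) ^ N| ≤ (1 / 2) ^ w := by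
  set q : ℝ := (1 / 2) ^ w with hq
  have hq0 : 0 < q := by positivity
  have hq1 : q ≤ 1 := pow_le_one₀ (by norm_num) (by norm_num)
  have hex : (1 - q) ^ (2 ^ w) ≤ 1 / 2 := by
    have h1 : (2 : ℝ) ≤ (1 + q) ^ (2 ^ w) := by
      have h := one_add_mul_le_pow (by linarith : -2 ≤ q) (2 ^ w)
      have h2 : ((2 ^ w : ℕ) : ℝ) * q = 1 := by
        rw [hq]; push_cast; rw [← mul_pow]; norm_num
      linarith
    have h3 : (1 - q) ^ (2 ^ w) * (1 + q) ^ (2 ^ w) ≤ 1 := by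
      rw [← mul_pow]
      exact pow_le_one₀ (mul_nonneg (by linarith) (by linarith)) (by nlinarith)
    have h4 : 0 ≤ (1 - q) ^ (2 ^ w) := pow_nonneg (by linarith) _
    nlinarith
  classical
  have hE : ∃ N : ℕ, (1 - q) ^ N ≤ 1 / 2 := ⟨_, hex⟩
  refine ⟨Nat.find hE, Nat.find_min' hE hex, ?_⟩
  have hs := Nat.find_spec hE
  obtain ⟨M, hM⟩ : ∃ M, Nat.find hE = M + 1 := by
    refine Nat.exists_eq_succ_of_ne_zero fun h => ?_
    rw [h] at hs
    norm_num at hs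
  have hlt : 1 / 2 < (1 - q) ^ M := by
    have := Nat.find_min hE (m := M) (by omega)
    exact not_le.1 this
  rw [hM] at hs ⊢
  rw [abs_of_nonneg (by linarith), pow_succ]
  nlinarith

theorem abs_one_add_pow_sub_one_le {s : ℝ} (hs : -1 ≤ s) {w : ℕ} (h : w * |s| ≤ 1) :
    |(1 + s) ^ w - 1| ≤ 2 * (w * |s|) := by
  have hws : |w * s| = w * |s| := by rw [abs_mul, Nat.abs_cast]
  have h1 : 1 + w * s ≤ (1 + s) ^ w := one_add_mul_le_pow (by linarith) w
  have h2 : (1 + s) ^ w ≤ Real.exp (w * s) := by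
    rw [Real.exp_nat_mul]
    exact pow_le_pow_left₀ (by linarith) (by linarith [Real.add_one_le_exp s]) w
  have h3 := Real.abs_exp_sub_one_le (x := w * s) (hws ▸ h)
  rw [hws] at h3
  have h4 := neg_abs_le (w * s)
  rw [hws] at h4
  have h5 : 0 ≤ w * |s| := by positivity
  rw [abs_le] at h3 ⊢
  constructor <;> linarith [h3.2]

theorem abs_dnfMean_le {n N w : ℕ} (hn : 0 < n) (hN : N ≤ 2 ^ w)
    (hNw : |1 - 2 * (1 - (1 / 2 : ℝ) ^ w) ^ N| ≤ (1 / 2) ^ w) (x : Fin n → Bool) :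
    |dnfMean N w x| ≤ (1 / 2) ^ w + 4 * w * |𝔼 i, sgn (x i)| := by
  have : Nonempty (Fin n) := ⟨⟨0, hn⟩⟩
  set s := 𝔼 i, sgn (x i) with hs
  have hs1 : |s| ≤ 1 :=
    (Finset.abs_expect_le ..).trans (Finset.expect_le univ_nonempty fun i _ => (abs_sgn _).le)
  have hbias : (𝔼 i, if x i then (1 : ℝ) else 0) = (1 + s) / 2 := by
    have : ∀ i, (if x i then (1 : ℝ) else 0) = (1 + sgn (x i)) / 2 := by
      intro i; cases x i <;> norm_num [sgn]
    simp only [this, ← Finset.expect_div, Finset.expect_add_distrib, Fintype.expect_const, hs]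
  have hs2 := abs_le.1 hs1
  have hp0 : 0 ≤ ((1 + s) / 2) ^ w := pow_nonneg (by linarith) _
  have hp1 : ((1 + s) / 2) ^ w ≤ 1 := pow_le_one₀ (by linarith) (by linarith)
  have hq0 : (0 : ℝ) < (1 / 2) ^ w := by positivity
  have hq1 : (1 / 2 : ℝ) ^ w ≤ 1 := pow_le_one₀ (by norm_num) (by norm_num)
  rw [dnfMean, hbias]
  by_cases hw : w * |s| ≤ 1
  · have h1 : |((1 + s) / 2) ^ w - (1 / 2) ^ w| ≤ (1 / 2) ^ w * (2 * (w * |s|)) := by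
      have : ((1 + s) / 2) ^ w - (1 / 2) ^ w = (1 / 2) ^ w * ((1 + s) ^ w - 1) := by
        rw [mul_sub, ← mul_pow]; ring_nf
      rw [this, abs_mul, abs_of_pos hq0]
      gcongr
      exact abs_one_add_pow_sub_one_le hs2.1 hw
    have h2 := abs_pow_sub_pow_le_mul (a := 1 - ((1 + s) / 2) ^ w) (b := 1 - (1 / 2) ^ w)
      (by rw [abs_le]; constructor <;> linarith) (by rw [abs_le]; constructor <;> linarith) N
    have h3 : (N : ℝ) * |(1 - ((1 + s) / 2) ^ w) - (1 - (1 / 2) ^ w)| ≤ 2 * (w * |s|) := by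
      have hNq : (N : ℝ) * (1 / 2) ^ w ≤ 1 := by
        have : (N : ℝ) ≤ 2 ^ w := by exact_mod_cast hN
        calc (N : ℝ) * (1 / 2) ^ w ≤ 2 ^ w * (1 / 2) ^ w := by gcongr
          _ = 1 := by rw [← mul_pow]; norm_num
      rw [sub_sub_sub_cancel_left, abs_sub_comm]
      calc (N : ℝ) * |((1 + s) / 2) ^ w - (1 / 2) ^ w|
          ≤ N * ((1 / 2) ^ w * (2 * (w * |s|))) := by gcongr
        _ = (N * (1 / 2) ^ w) * (2 * (w * |s|)) := by ring
        _ ≤ 2 * (w * |s|) := mul_le_of_le_one_left (by positivity) hNq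
    have h4 := abs_le.1 (h2.trans h3)
    have h5 := abs_le.1 hNw
    rw [abs_le]
    constructor <;> linarith
  · have h1 : 0 ≤ (1 - ((1 + s) / 2) ^ w) ^ N := pow_nonneg (by linarith) _
    have h2 : (1 - ((1 + s) / 2) ^ w) ^ N ≤ 1 := pow_le_one₀ (by linarith) (by linarith)
    rw [abs_le]
    constructor <;> nlinarith

theorem card_filter_card_le {n : ℕ} (hn : 2 ≤ n) (d : ℕ) :
    #{S : Finset (Fin n) | #S ≤ d} ≤ n ^ (d + 1) := by
  calc #{S : Finset (Fin n) | #S ≤ d}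
      ≤ #((range (d + 1)).biUnion fun k => powersetCard k (univ : Finset (Fin n))) := by
        refine Finset.card_le_card fun S hS => ?_
        simp only [mem_filter, mem_univ, true_and] at hS
        simp only [mem_biUnion, mem_range, mem_powersetCard, subset_univ, true_and]
        exact ⟨#S, by omega, rfl⟩
    _ ≤ ∑ k ∈ range (d + 1), #(powersetCard k (univ : Finset (Fin n))) := card_biUnion_le
    _ ≤ ∑ k ∈ range (d + 1), n ^ k := by
        refine Finset.sum_le_sum fun k _ => ?_
        rw [card_powersetCard, card_univ, Fintype.card_fin]
        exact Nat.choose_le_pow n k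
    _ ≤ n ^ (d + 1) := (Nat.geomSum_lt hn fun k hk => by simpa using hk).le

theorem exists_monotone_approxResilient_zero {n : ℕ} (hn : 0 < n) {α : ℝ} (hα : 0 ≤ α) :
    ∃ f : (Fin n → Bool) → ℝ, IsBooleanValued f ∧ Monotone f ∧ ApproxResilient α 0 f := by
  have hbool : IsBooleanValued fun x : Fin n → Bool => sgn (x ⟨0, hn⟩) := by
    intro x
    cases h : x ⟨0, hn⟩ <;> simp [sgn, h]
  refine ⟨fun x => sgn (x ⟨0, hn⟩), hbool, ?_, fun x => sgn (x ⟨0, hn⟩), ?_, ?_, ?_⟩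
  · intro x y hxy
    have := Bool.le_iff_imp.1 (hxy ⟨0, hn⟩)
    simp only [sgn]
    split_ifs <;> simp_all
  · intro S hS
    have hS' : S = ∅ := by simpa using hS
    have h := expect_parity_mul_parity {(⟨0, hn⟩ : Fin n)} ∅
    rw [if_neg (Finset.singleton_ne_empty _)] at h
    rw [fcoef_eq_expect_parity, hS', ← h]
    simp [parity]
  · intro x
    exact (abs_sgn _).le
  · simpa [expect_eq_finset_expect] using hα

theorem two_thirds_pow_le {n L : ℕ} (hn : 0 < n) (hL : 15 * Real.log n ≤ L) :
    (2 / 3 : ℝ) ^ L ≤ ((n : ℝ) ^ 5)⁻¹ := by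
  have hn' : (0 : ℝ) < n := by exact_mod_cast hn
  have h1 : (n : ℝ) ^ 5 ≤ (3 / 2) ^ L := by
    rw [← Real.log_le_log_iff (by positivity) (by positivity), Real.log_pow, Real.log_pow]
    have h2 := Real.one_sub_inv_le_log_of_pos (by norm_num : (0 : ℝ) < 3 / 2)
    have h3 : (0 : ℝ) ≤ L := Nat.cast_nonneg L
    push_cast
    nlinarith
  rw [show (2 / 3 : ℝ) = (3 / 2)⁻¹ by norm_num, inv_pow]
  exact inv_anti₀ (by positivity) h1

theorem exists_monotone_approxResilient {n d : ℕ} (hn : 6 ≤ n) (hd : 0 < d) {α : ℝ}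
    (hα0 : 0 < α) (hα1 : α ≤ 1) (h : 1024 * (d * Real.log n) ≤ α * √n) :
    ∃ f : (Fin n → Bool) → ℝ, IsBooleanValued f ∧ Monotone f ∧ ApproxResilient α d f := by
  have hn0 : 0 < n := by omega
  have hnR : (6 : ℝ) ≤ n := by exact_mod_cast hn
  have hd1 : (1 : ℝ) ≤ d := by exact_mod_cast hd
  have hlog : 1 ≤ Real.log n := by
    rw [Real.le_log_iff_exp_le (by linarith)]
    linarith [Real.exp_one_lt_d9]
  have hsqrt1 : 1 ≤ √(n : ℝ) := Real.one_le_sqrt.2 (by linarith)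
  have hsqrt : √(n : ℝ) ≤ n := Real.sqrt_le_iff.2 ⟨by linarith, by nlinarith⟩
  obtain ⟨L, hL, hL'⟩ : ∃ L : ℕ, 15 * Real.log n ≤ L ∧ (L : ℝ) ≤ 16 * Real.log n := by
    refine ⟨⌈15 * Real.log n⌉₊, Nat.le_ceil _, ?_⟩
    linarith [Nat.ceil_lt_add_one (by linarith : 0 ≤ 15 * Real.log n)]
  have hLd : (L * d : ℝ) ≤ 16 * (d * Real.log n) := by nlinarith
  have hαn : 1 / n ≤ α := by
    rw [div_le_iff₀ (by linarith)]
    nlinarith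
  have hw : 12 * (2 * (L * d)) ≤ n := by
    have : (12 * (2 * (L * d)) : ℝ) ≤ n := by nlinarith
    exact_mod_cast this
  obtain ⟨N, hN, hNw⟩ := exists_pow_near_half (2 * (L * d))
  obtain ⟨T, hT⟩ := exists_dnf_approxResilient hn0 hw N d
  refine ⟨dnf T, dnf_isBooleanValued T, dnf_monotone T, ?_⟩
  obtain ⟨g, hg1, hg2, hg3⟩ := hT
  refine ⟨g, hg1, hg2, hg3.trans ?_⟩
  set r : ℝ := (2 / 3) ^ (L * d) with hr
  have hr0 : 0 ≤ r := by positivity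
  have hr_le : r ≤ (((n : ℝ) ^ 5)⁻¹) ^ d := by
    rw [hr, pow_mul]
    exact pow_le_pow_left₀ (by positivity) (two_thirds_pow_le hn0 hL) d
  have hhalf : (1 / 2 : ℝ) ^ (2 * (L * d)) ≤ r := by
    rw [hr, pow_mul]
    exact pow_le_pow_left₀ (by norm_num) (by norm_num) _
  have hmean : 𝔼 x : Fin n → Bool, |dnfMean N (2 * (L * d)) x| ≤ r + 8 * (L * d) * (1 / √n) := by
    calc 𝔼 x : Fin n → Bool, |dnfMean N (2 * (L * d)) x|
        ≤ 𝔼 x : Fin n → Bool, ((1 / 2) ^ (2 * (L * d)) +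
            4 * (2 * (L * d) : ℕ) * |𝔼 i, sgn (x i)|) :=
          Finset.expect_le_expect fun x _ => abs_dnfMean_le hn0 hN hNw x
      _ ≤ r + 8 * (L * d) * (1 / √n) := by
          rw [Finset.expect_add_distrib, Fintype.expect_const, ← Finset.mul_expect]
          push_cast
          rw [show (4 * (2 * (L * d)) : ℝ) = 8 * (L * d) by ring]
          gcongr
          exact expect_abs_bias_le hn0
  have hbias : 8 * (L * d) * (1 / √n) ≤ α / 8 := by
    rw [mul_one_div, div_le_iff₀ (by linarith)]
    linarith
  have hV : √(2 * N * (1 / 3) ^ (2 * (L * d))) ≤ 2 * r := by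
    refine Real.sqrt_le_iff.2 ⟨by positivity, ?_⟩
    have hN' : (N : ℝ) ≤ 2 ^ (2 * (L * d)) := by exact_mod_cast hN
    have hr2 : (2 : ℝ) ^ (2 * (L * d)) * (1 / 3) ^ (2 * (L * d)) = r ^ 2 := by
      rw [← mul_pow, hr, ← pow_mul, mul_comm 2 (L * d)]
      norm_num
    have : (N : ℝ) * (1 / 3) ^ (2 * (L * d)) ≤ r ^ 2 := by
      rw [← hr2]
      gcongr
    nlinarith [sq_nonneg r]
  have hK : (#{S : Finset (Fin n) | #S ≤ d} : ℝ) ≤ ((n : ℝ) ^ 2) ^ d := by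
    have h1 := card_filter_card_le (by omega : 2 ≤ n) d
    have h2 : n ^ (d + 1) ≤ (n ^ 2) ^ d := by
      rw [← pow_mul]
      exact Nat.pow_le_pow_right hn0 (by omega)
    exact_mod_cast h1.trans h2
  have hcube : ((n : ℝ) ^ 2) ^ d * r ≤ ((n : ℝ) ^ 3)⁻¹ := by
    calc ((n : ℝ) ^ 2) ^ d * r ≤ ((n : ℝ) ^ 2) ^ d * (((n : ℝ) ^ 5)⁻¹) ^ d := by gcongr
      _ = (((n : ℝ) ^ 3)⁻¹) ^ d := by
          rw [← mul_pow]
          congr 1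
          field_simp
      _ ≤ (((n : ℝ) ^ 3)⁻¹) ^ 1 := by
          refine pow_le_pow_of_le_one (by positivity) ?_ hd
          exact inv_le_one_of_one_le₀ (one_le_pow₀ (by linarith))
      _ = _ := pow_one _
  have hinv : ((n : ℝ) ^ 3)⁻¹ ≤ α / 36 := by
    calc ((n : ℝ) ^ 3)⁻¹ = 1 / n * (1 / (n : ℝ) ^ 2) := by field_simp
      _ ≤ α * (1 / 36) := by
          gcongr
          nlinarith
      _ = α / 36 := by ring
  have hr_small : 36 * r ≤ α / 36 := by
    have h36 : (36 : ℝ) ≤ ((n : ℝ) ^ 2) ^ d := by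
      calc (36 : ℝ) ≤ ((n : ℝ) ^ 2) ^ 1 := by nlinarith
        _ ≤ ((n : ℝ) ^ 2) ^ d := pow_le_pow_right₀ (one_le_pow₀ (by linarith)) hd
    have : 36 * r ≤ ((n : ℝ) ^ 2) ^ d * r := by gcongr
    linarith
  have hmain : (#{S : Finset (Fin n) | #S ≤ d} : ℝ) * √(2 * N * (1 / 3) ^ (2 * (L * d))) ≤
      2 * (((n : ℝ) ^ 2) ^ d * r) := by
    calc _ ≤ ((n : ℝ) ^ 2) ^ d * (2 * r) := by gcongr
      _ = _ := by ring
  linarith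

/-- **Existence of monotone functions with near-optimal approximate resilience.** There are
universal constants `c > 0` and `n₀` such that for every `n ≥ n₀` and every `α ∈ (0,1)`, there
exists a monotone Boolean function `f : {-1,1}^n → {-1,1}` that is `α`-approximately
`d`-resilient with `d = ⌊c·α·√n/log n⌋`.  (Monotonicity is with respect to the coordinatewise
order with `-1 ≤ 1`, i.e. `false ≤ true`.) -/
theorem stmt7 :
    ∃ c : ℝ, 0 < c ∧ ∃ n₀ : ℕ,
      ∀ n : ℕ, n₀ ≤ n → ∀ α : ℝ, 0 < α → α < 1 →
        ∃ f : (Fin n → Bool) → ℝ, IsBooleanValued f ∧ Monotone f ∧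
          ApproxResilient α ⌊c * α * Real.sqrt n / Real.log n⌋₊ f := by
  refine ⟨1 / 1024, by norm_num, 6, fun n hn α hα0 hα1 => ?_⟩
  rcases Nat.eq_zero_or_pos ⌊1 / 1024 * α * √n / Real.log n⌋₊ with hd | hd
  · rw [hd]
    exact exists_monotone_approxResilient_zero (by omega) hα0.le
  · refine exists_monotone_approxResilient hn hd hα0 hα1.le ?_
    have hlog : 0 < Real.log n := Real.log_pos (by exact_mod_cast (by omega : 1 < n))
    have h := Nat.floor_le (by positivity : 0 ≤ 1 / 1024 * α * √n / Real.log n)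
    rw [le_div_iff₀ hlog] at h
    linarith
end
end
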